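/- arXiv:1610.01596 — 9 statements merged into one kernel-verified Lean document; each statement's English description precedes it below -/
import Mathlib

section
/- Fix an integer k ≥ 4. Then P_k is a proper subset of Σ_k, and Σ_k is a proper subset of C_k. (This is the algebraic part of the paper's main theorem: the conjectured cut loci P_k and Σ_k are strictly contained in the set of cut points C_k.) -/
open Matrix

noncomputable section

/-- `v ∧ w = v wᵀ − w vᵀ`. -/
def wedge {k : ℕ} (v w : Fin k → ℝ) : Matrix (Fin k) (Fin k) ℝ :=
  vecMulVec v w - vecMulVec w v

/-- The conjectured cut locus `P_k` of Myasnichenko. -/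
def Pset (k : ℕ) : Set ((Fin k → ℝ) × Matrix (Fin k) (Fin k) ℝ) :=
  {p | p.2ᵀ = -p.2 ∧ (∃ v w, p.2 = wedge v w) ∧ p.2 ≠ 0 ∧ p.2.mulVec p.1 = 0}

/-- The conjectured cut locus `Σ_k` of Montanari–Morbidelli. -/
def Sigmaset (k : ℕ) : Set ((Fin k → ℝ) × Matrix (Fin k) (Fin k) ℝ) :=
  {p | p.2ᵀ = -p.2 ∧ p.2 ≠ 0 ∧ p.2.mulVec p.1 = 0}

/-- The set of cut points `C_k`: points `(x,Y)` with `Y ≠ 0` admitting a nontrivial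
orthogonal stabilizer fixing `x` and fixing `ker Y` pointwise. -/
def Cset (k : ℕ) : Set ((Fin k → ℝ) × Matrix (Fin k) (Fin k) ℝ) :=
  {p | p.2ᵀ = -p.2 ∧ p.2 ≠ 0 ∧ ∃ M : Matrix (Fin k) (Fin k) ℝ,
    M * Mᵀ = 1 ∧ M ≠ 1 ∧ M.mulVec p.1 = p.1 ∧ M * p.2 * Mᵀ = p.2 ∧
    ∀ v : Fin k → ℝ, p.2.mulVec v = 0 → M.mulVec v = v}

/-- A real skew-symmetric matrix has no eigenvalue `1`. -/
theorem isUnit_det_one_sub_of_transpose_eq_neg {k : ℕ} {Y : Matrix (Fin k) (Fin k) ℝ}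
    (hY : Yᵀ = -Y) : IsUnit (1 - Y).det := by
  rw [isUnit_iff_ne_zero]
  intro hdet
  obtain ⟨v, hv, hYv⟩ := exists_mulVec_eq_zero_iff.mpr hdet
  rw [sub_mulVec, one_mulVec, sub_eq_zero] at hYv
  have hskew : v ⬝ᵥ Y *ᵥ v = -(v ⬝ᵥ Y *ᵥ v) := by
    conv_lhs => rw [dotProduct_mulVec, ← mulVec_transpose, hY, neg_mulVec, neg_dotProduct,
      dotProduct_comm]
  rw [← hYv] at hskew
  exact hv (dotProduct_self_eq_zero.mp (by linarith))

/-- The Cayley transform `(1 - Y)⁻¹ (1 + Y)` is a nontrivial orthogonal matrix commuting with `Y`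
and fixing `ker Y`. -/
theorem exists_orthogonal_stabilizer {k : ℕ} {Y : Matrix (Fin k) (Fin k) ℝ}
    (hY : Yᵀ = -Y) (hY0 : Y ≠ 0) :
    ∃ M : Matrix (Fin k) (Fin k) ℝ, M * Mᵀ = 1 ∧ M ≠ 1 ∧ M * Y * Mᵀ = Y ∧
      ∀ v : Fin k → ℝ, Y *ᵥ v = 0 → M *ᵥ v = v := by
  have hu := isUnit_det_one_sub_of_transpose_eq_neg hY
  have hl : (1 - Y)⁻¹ * (1 - Y) = 1 := nonsing_inv_mul _ hu
  have hr : (1 - Y) * (1 - Y)⁻¹ = 1 := mul_nonsing_inv _ hu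
  set N := (1 - Y)⁻¹
  have ht : (1 + Y) * Nᵀ = 1 := by
    simpa [transpose_mul, hY] using congrArg transpose hl
  have hcomm : (1 + Y) * (1 - Y) = (1 - Y) * (1 + Y) := by noncomm_ring
  have hT : (N * (1 + Y))ᵀ = (1 - Y) * Nᵀ := by
    simp [transpose_mul, hY, sub_eq_add_neg]
  have horth : N * (1 + Y) * (N * (1 + Y))ᵀ = 1 := by
    rw [hT]
    calc N * (1 + Y) * ((1 - Y) * Nᵀ) = N * ((1 + Y) * (1 - Y)) * Nᵀ := by simp only [mul_assoc]
      _ = (N * (1 - Y)) * ((1 + Y) * Nᵀ) := by rw [hcomm]; simp only [mul_assoc]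
      _ = 1 := by rw [hl, ht, one_mul]
  have hNY : N * Y = Y * N := by
    calc N * Y = N * (Y * ((1 - Y) * N)) := by rw [hr, mul_one]
      _ = N * (1 - Y) * (Y * N) := by noncomm_ring
      _ = Y * N := by rw [hl, one_mul]
  refine ⟨N * (1 + Y), horth, fun h => hY0 ?_, ?_, fun v hv => ?_⟩
  · have h' : 1 + Y = 1 - Y := by
      calc 1 + Y = (1 - Y) * (N * (1 + Y)) := by rw [← mul_assoc, hr, one_mul]
        _ = 1 - Y := by rw [h, mul_one]
    ext i j
    have := congrFun (congrFun h' i) j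
    simp only [Matrix.add_apply, Matrix.sub_apply] at this
    simp only [Matrix.zero_apply]
    linarith
  · have hMY : N * (1 + Y) * Y = Y * (N * (1 + Y)) := by
      calc N * (1 + Y) * Y = N * Y * (1 + Y) := by noncomm_ring
        _ = Y * (N * (1 + Y)) := by rw [hNY, mul_assoc]
    rw [hMY, mul_assoc, horth, mul_one]
  · have h1 : (1 + Y) *ᵥ v = (1 - Y) *ᵥ v := by
      rw [add_mulVec, sub_mulVec, hv, add_zero, sub_zero]
    rw [← mulVec_mulVec, h1, mulVec_mulVec, hl, one_mulVec]

theorem Sigmaset_subset_Cset (k : ℕ) : Sigmaset k ⊆ Cset k := by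
  rintro ⟨x, Y⟩ ⟨hY, hY0, hx⟩
  obtain ⟨M, h1, h2, h3, h4⟩ := exists_orthogonal_stabilizer hY hY0
  exact ⟨hY, hY0, M, h1, h2, h4 x hx, h3, h4⟩

theorem transpose_wedge {k : ℕ} (v w : Fin k → ℝ) : (wedge v w)ᵀ = -wedge v w := by
  simp [wedge]

/-- The Plücker relation for decomposable bivectors. -/
theorem wedge_pluecker {k : ℕ} (v w : Fin k → ℝ) (a b c d : Fin k) :
    wedge v w a b * wedge v w c d - wedge v w a c * wedge v w b d
      + wedge v w a d * wedge v w b c = 0 := by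
  simp only [wedge, Matrix.sub_apply, vecMulVec_apply]
  ring

/-- The bivector `e_a ∧ e_b + e_c ∧ e_d`. -/
def sumWedge {k : ℕ} (a b c d : Fin k) : Matrix (Fin k) (Fin k) ℝ :=
  wedge (Pi.single a 1) (Pi.single b 1) + wedge (Pi.single c 1) (Pi.single d 1)

theorem transpose_sumWedge {k : ℕ} (a b c d : Fin k) :
    (sumWedge a b c d)ᵀ = -sumWedge a b c d := by
  simp only [sumWedge, transpose_add, transpose_wedge, neg_add]

section Distinct

variable {k : ℕ} {a b c d : Fin k}

theorem sumWedge_ne_zero (hab : a ≠ b) (hac : a ≠ c) (had : a ≠ d) :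
    sumWedge a b c d ≠ 0 := fun h => by
  have := congrFun (congrFun h a) b
  simp [sumWedge, wedge, vecMulVec_apply, Pi.single_apply, hab, hac, had] at this

theorem sumWedge_ne_wedge (hab : a ≠ b) (hac : a ≠ c) (had : a ≠ d) (hbc : b ≠ c) (hbd : b ≠ d)
    (hcd : c ≠ d) (v w : Fin k → ℝ) : sumWedge a b c d ≠ wedge v w := fun h => by
  have := wedge_pluecker v w a b c d
  rw [← h] at this
  simp [sumWedge, wedge, vecMulVec_apply, hab, hac, had, hbc, hbd, hcd,
    hab.symm, hac.symm, had.symm, hbc.symm, hbd.symm, hcd.symm] at this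

theorem sumWedge_mulVec (v : Fin k → ℝ) :
    sumWedge a b c d *ᵥ v =
      v b • Pi.single a 1 - v a • Pi.single b 1 + (v d • Pi.single c 1 - v c • Pi.single d 1) := by
  simp [sumWedge, wedge, add_mulVec, sub_mulVec, vecMulVec_mulVec]

theorem single_sumWedge_mem_Cset (hab : a ≠ b) (hac : a ≠ c) (had : a ≠ d) (hbc : b ≠ c)
    (hbd : b ≠ d) (hcd : c ≠ d) : (Pi.single a 1, sumWedge a b c d) ∈ Cset k := by
  refine ⟨transpose_sumWedge a b c d, sumWedge_ne_zero hab hac had,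
    diagonal fun i => if i = c ∨ i = d then -1 else 1, ?_, ?_, ?_, ?_, fun v hv => ?_⟩
  · rw [diagonal_transpose, diagonal_mul_diagonal, ← diagonal_one]
    congr 1
    funext i
    split_ifs <;> norm_num
  · intro h
    have := congrFun (congrFun h c) c
    norm_num at this
  · funext i
    rw [mulVec_diagonal]
    by_cases hi : i = a
    · subst hi
      simp [hac, had]
    · simp [hi]
  · ext i j
    rw [diagonal_transpose, mul_diagonal, diagonal_mul]
    simp only [sumWedge, wedge, Matrix.add_apply, Matrix.sub_apply, vecMulVec_apply,
      Pi.single_apply]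
    grind
  · rw [sumWedge_mulVec] at hv
    have hc := congrFun hv c
    have hd := congrFun hv d
    simp [hac.symm, hbc.symm, hcd] at hc
    simp [had.symm, hbd.symm, hcd.symm] at hd
    funext i
    rw [mulVec_diagonal]
    split_ifs with hi
    · rcases hi with rfl | rfl <;> simp [hc, hd]
    · rw [one_mul]

end Distinct

/-- For every `k ≥ 4`, the conjectured cut loci `P_k` and `Σ_k` are strictly contained in the
set of cut points `C_k`. -/
theorem Pset_ssubset_Sigmaset_ssubset_Cset (k : ℕ) (hk : 4 ≤ k) :
    Pset k ⊂ Sigmaset k ∧ Sigmaset k ⊂ Cset k := by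
  have h0 : 0 < k := by omega
  have h1 : 1 < k := by omega
  have h2 : 2 < k := by omega
  have h3 : 3 < k := by omega
  let a : Fin k := ⟨0, h0⟩
  let b : Fin k := ⟨1, h1⟩
  let c : Fin k := ⟨2, h2⟩
  let d : Fin k := ⟨3, h3⟩
  have hab : a ≠ b := by simp [a, b]
  have hac : a ≠ c := by simp [a, c]
  have had : a ≠ d := by simp [a, d]
  have hbc : b ≠ c := by simp [b, c]
  have hbd : b ≠ d := by simp [b, d]
  have hcd : c ≠ d := by simp [c, d]
  refine ⟨⟨fun p hp => ⟨hp.1, hp.2.2⟩, fun h => ?_⟩, Sigmaset_subset_Cset k, fun h => ?_⟩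
  · obtain ⟨-, ⟨v, w, hvw⟩, -⟩ := @h (0, sumWedge a b c d)
      ⟨transpose_sumWedge a b c d, sumWedge_ne_zero hab hac had, mulVec_zero _⟩
    exact sumWedge_ne_wedge hab hac had hbc hbd hcd v w hvw
  · obtain ⟨-, -, hx⟩ := h (single_sumWedge_mem_Cset hab hac had hbc hbd hcd)
    rw [sumWedge_mulVec] at hx
    have := congrFun hx b
    simp [hab.symm, hac.symm, had.symm] at this
end
end

section
/- Spectral characterization of C_k: let Y ∈ Skew_k with Y ≠ 0 and x ∈ ℝ^k. Then (x,Y) ∈ C_k if and only if there exists α > 0 such that the subspace E_α := ker(Y·Y + α²·1) of ℝ^k is nonzero and moreover either the orthogonal projection of x onto E_α is zero, or dim E_α ≥ 4. -/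
open Matrix

noncomputable section

/-- The real eigenspace `E_α = ker(Y² + α² I)` of a skew-symmetric matrix `Y`,
associated with the pair of purely imaginary eigenvalues `± i α`. -/
def eigSpace {k : ℕ} (Y : Matrix (Fin k) (Fin k) ℝ) (α : ℝ) : Submodule ℝ (Fin k → ℝ) :=
  LinearMap.ker (Y * Y + α ^ 2 • (1 : Matrix (Fin k) (Fin k) ℝ)).mulVecLin

section SpectralCharacterization

variable {k : ℕ}

lemma mem_eigSpace_iff {Y : Matrix (Fin k) (Fin k) ℝ} {α : ℝ} {v : Fin k → ℝ} :
    v ∈ eigSpace Y α ↔ Y *ᵥ (Y *ᵥ v) = -(α ^ 2) • v := by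
  rw [eigSpace, LinearMap.mem_ker, mulVecLin_apply, add_mulVec, smul_mulVec, one_mulVec,
    ← mulVec_mulVec, neg_smul, eq_neg_iff_add_eq_zero]

lemma mulVec_dotProduct_of_skew {Y : Matrix (Fin k) (Fin k) ℝ} (hskew : Yᵀ = -Y)
    (a b : Fin k → ℝ) : Y *ᵥ a ⬝ᵥ b = -(a ⬝ᵥ Y *ᵥ b) := by
  rw [dotProduct_mulVec, ← mulVec_transpose, hskew, neg_mulVec, neg_dotProduct, neg_neg]

lemma dotProduct_mulVec_self_of_skew {Y : Matrix (Fin k) (Fin k) ℝ} (hskew : Yᵀ = -Y)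
    (a : Fin k → ℝ) : a ⬝ᵥ Y *ᵥ a = 0 := by
  have h := mulVec_dotProduct_of_skew hskew a a
  rw [dotProduct_comm] at h
  linarith

lemma mulVec_mem_eigSpace {Y : Matrix (Fin k) (Fin k) ℝ} {α : ℝ} {v : Fin k → ℝ}
    (hv : v ∈ eigSpace Y α) : Y *ᵥ v ∈ eigSpace Y α := by
  rw [mem_eigSpace_iff] at hv ⊢
  rw [hv, mulVec_smul]

lemma mulVec_dotProduct_mulVec_of_mem_eigSpace {Y : Matrix (Fin k) (Fin k) ℝ}
    (hskew : Yᵀ = -Y) {α : ℝ} {b : Fin k → ℝ} (hb : b ∈ eigSpace Y α) (a : Fin k → ℝ) :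
    Y *ᵥ a ⬝ᵥ Y *ᵥ b = α ^ 2 * (a ⬝ᵥ b) := by
  rw [mulVec_dotProduct_of_skew hskew, mem_eigSpace_iff.1 hb, dotProduct_smul, smul_eq_mul]
  ring

lemma mulVec_ne_zero_of_mem_eigSpace {Y : Matrix (Fin k) (Fin k) ℝ} {α : ℝ} (hα : 0 < α)
    {v : Fin k → ℝ} (hv : v ∈ eigSpace Y α) (hv0 : v ≠ 0) : Y *ᵥ v ≠ 0 := by
  intro h
  rw [mem_eigSpace_iff, h, mulVec_zero] at hv
  rcases smul_eq_zero.1 hv.symm with h' | h'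
  · nlinarith [pow_pos hα 2]
  · exact hv0 h'

/-- Nonzero pairwise orthogonal vectors are linearly independent. -/
lemma linearIndependent_of_pairwise_dotProduct_eq_zero {ι : Type*} [Fintype ι]
    {v : ι → Fin k → ℝ} (h0 : ∀ i, v i ≠ 0) (h : Pairwise fun i j => v i ⬝ᵥ v j = 0) :
    LinearIndependent ℝ v := by
  rw [Fintype.linearIndependent_iff]
  intro c hc i
  have h1 : v i ⬝ᵥ ∑ j, c j • v j = c i * (v i ⬝ᵥ v i) := by
    rw [dotProduct_sum, Finset.sum_eq_single i]
    · rw [dotProduct_smul, smul_eq_mul]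
    · intro j _ hj
      rw [dotProduct_smul, h hj.symm, smul_zero]
    · simp
  rw [hc, dotProduct_zero] at h1
  exact (mul_eq_zero.1 h1.symm).resolve_right fun h2 => h0 i (dotProduct_self_eq_zero.1 h2)

/-- If two nonzero vectors `g, v` of `E_α` satisfy `v ⊥ g` and `v ⊥ Y g`, then
`g, Y g, v, Y v` are independent, so `dim E_α ≥ 4`. -/
lemma four_le_finrank_eigSpace {Y : Matrix (Fin k) (Fin k) ℝ} (hskew : Yᵀ = -Y)
    {α : ℝ} (hα : 0 < α) {g v : Fin k → ℝ} (hg : g ∈ eigSpace Y α) (hv : v ∈ eigSpace Y α)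
    (hg0 : g ≠ 0) (hv0 : v ≠ 0) (hvg : v ⬝ᵥ g = 0) (hvYg : v ⬝ᵥ Y *ᵥ g = 0) :
    4 ≤ Module.finrank ℝ (eigSpace Y α) := by
  have hgYg := dotProduct_mulVec_self_of_skew hskew g
  have hvYv := dotProduct_mulVec_self_of_skew hskew v
  have hYvg : Y *ᵥ v ⬝ᵥ g = 0 := by rw [mulVec_dotProduct_of_skew hskew, hvYg, neg_zero]
  have hYvYg : Y *ᵥ v ⬝ᵥ Y *ᵥ g = 0 := by
    rw [mulVec_dotProduct_mulVec_of_mem_eigSpace hskew hg, hvg, mul_zero]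
  have hgv := dotProduct_comm v g ▸ hvg
  have hYgv := dotProduct_comm v (Y *ᵥ g) ▸ hvYg
  have hYgg := dotProduct_comm g (Y *ᵥ g) ▸ hgYg
  have hYvv := dotProduct_comm v (Y *ᵥ v) ▸ hvYv
  have hgYv := dotProduct_comm (Y *ᵥ v) g ▸ hYvg
  have hYgYv := dotProduct_comm (Y *ᵥ v) (Y *ᵥ g) ▸ hYvYg
  let w : Fin 4 → eigSpace Y α :=
    ![⟨g, hg⟩, ⟨Y *ᵥ g, mulVec_mem_eigSpace hg⟩, ⟨v, hv⟩, ⟨Y *ᵥ v, mulVec_mem_eigSpace hv⟩]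
  have hw : LinearIndependent ℝ fun i => (w i : Fin k → ℝ) := by
    apply linearIndependent_of_pairwise_dotProduct_eq_zero
    · intro i
      fin_cases i
      · exact hg0
      · exact mulVec_ne_zero_of_mem_eigSpace hα hg hg0
      · exact hv0
      · exact mulVec_ne_zero_of_mem_eigSpace hα hv hv0
    · intro i j hij
      fin_cases i <;> fin_cases j <;> first | exact absurd rfl hij | assumption
  have hw' : LinearIndependent ℝ w := LinearIndependent.of_comp (eigSpace Y α).subtype hw
  simpa using hw'.fintype_card_le_finrank

/-- A matrix killing every eigenspace `E_α` with `α > 0` and the kernel of `Y` is zero. -/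
lemma eq_zero_of_forall_mem_eigSpace {Y N : Matrix (Fin k) (Fin k) ℝ} (hskew : Yᵀ = -Y)
    (hker : ∀ v, Y *ᵥ v = 0 → N *ᵥ v = 0)
    (heig : ∀ α : ℝ, 0 < α → ∀ v ∈ eigSpace Y α, N *ᵥ v = 0) : N = 0 := by
  have hS : (Yᴴ * Y).PosSemidef := posSemidef_conjTranspose_mul_self Y
  have hSY : Yᴴ * Y = -(Y * Y) := by
    rw [conjTranspose_eq_transpose_of_trivial, hskew, neg_mul]
  have hN : ∀ i, N *ᵥ ⇑(hS.isHermitian.eigenvectorBasis i) = 0 := by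
    intro i
    set v : Fin k → ℝ := ⇑(hS.isHermitian.eigenvectorBasis i)
    have hv : (Yᴴ * Y) *ᵥ v = hS.isHermitian.eigenvalues i • v :=
      hS.isHermitian.mulVec_eigenvectorBasis i
    have hYYv : Y *ᵥ (Y *ᵥ v) = -(hS.isHermitian.eigenvalues i) • v := by
      rw [neg_smul, ← hv, hSY, neg_mulVec, neg_neg, mulVec_mulVec]
    rcases (hS.eigenvalues_nonneg i).eq_or_lt with h0 | hpos
    · apply hker
      rw [← dotProduct_self_eq_zero, mulVec_dotProduct_of_skew hskew, hYYv, ← h0]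
      simp
    · refine heig _ (Real.sqrt_pos.2 hpos) v (mem_eigSpace_iff.2 ?_)
      rw [Real.sq_sqrt hpos.le, hYYv]
  have hlin : toEuclideanLin N = 0 := by
    refine hS.isHermitian.eigenvectorBasis.toBasis.ext fun i => ?_
    rw [OrthonormalBasis.coe_toBasis, LinearMap.zero_apply]
    ext j
    exact congrFun (hN i) j
  exact (LinearEquiv.map_eq_zero_iff _).1 hlin

/-- Membership in `C_k` means that `x ⊥ g, Y g` for some nonzero `g` in some `E_α`. -/
lemma exists_mem_eigSpace_of_mem_Cset {x : Fin k → ℝ} {Y : Matrix (Fin k) (Fin k) ℝ}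
    (h : (x, Y) ∈ Cset k) :
    ∃ α : ℝ, 0 < α ∧ ∃ g ∈ eigSpace Y α, g ≠ 0 ∧ x ⬝ᵥ g = 0 ∧ x ⬝ᵥ Y *ᵥ g = 0 := by
  obtain ⟨hskew, -, M, hMM, hM1, hMx, hMY, hMker⟩ := h
  dsimp only at hskew hMx hMY hMker
  have hMM' : Mᵀ * M = 1 := mul_eq_one_comm.1 hMM
  have hcomm : M * Y = Y * M := by
    calc M * Y = M * Y * (Mᵀ * M) := by rw [hMM', mul_one]
      _ = Y * M := by rw [← mul_assoc, hMY]
  have hcommv (v : Fin k → ℝ) : Y *ᵥ (M *ᵥ v) = M *ᵥ (Y *ᵥ v) := by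
    rw [mulVec_mulVec, mulVec_mulVec, hcomm]
  have hxM (v : Fin k → ℝ) : x ⬝ᵥ M *ᵥ v = x ⬝ᵥ v := by
    have hx : x ᵥ* M = x := by
      rw [← mulVec_transpose, ← congrArg (Mᵀ *ᵥ ·) hMx]
      simp only [mulVec_mulVec, hMM', one_mulVec]
    rw [dotProduct_mulVec, hx]
  by_contra! hcon
  refine hM1 (sub_eq_zero.1 (eq_zero_of_forall_mem_eigSpace (N := M - 1) hskew ?_ ?_))
  · intro v hv
    rw [sub_mulVec, one_mulVec, hMker v hv, sub_self]
  · intro α hα v hv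
    rw [sub_mulVec, one_mulVec]
    by_contra hne
    refine hcon α hα (M *ᵥ v - v) (Submodule.sub_mem _ ?_ hv) hne ?_ ?_
    · rw [mem_eigSpace_iff] at hv ⊢
      rw [hcommv, hcommv, hv, mulVec_smul]
    · rw [dotProduct_sub, hxM, sub_self]
    · rw [mulVec_sub, hcommv, dotProduct_sub, hxM, sub_self]

/-- Minus the identity on `span (g, Y g)` and the identity on the orthogonal complement is a
nontrivial orthogonal matrix witnessing membership in `C_k`. -/
lemma mem_Cset_of_mem_eigSpace {x : Fin k → ℝ} {Y : Matrix (Fin k) (Fin k) ℝ}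
    (hskew : Yᵀ = -Y) (hY : Y ≠ 0) {α : ℝ} (hα : 0 < α) {g : Fin k → ℝ}
    (hg : g ∈ eigSpace Y α) (hg0 : g ≠ 0) (hxg : x ⬝ᵥ g = 0) (hxYg : x ⬝ᵥ Y *ᵥ g = 0) :
    (x, Y) ∈ Cset k := by
  have hYYg := mem_eigSpace_iff.1 hg
  have hgw := dotProduct_mulVec_self_of_skew hskew g
  have hww := mulVec_dotProduct_mulVec_of_mem_eigSpace hskew hg g
  have hgY : g ᵥ* Y = -(Y *ᵥ g) := by rw [← mulVec_transpose, hskew, neg_mulVec]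
  have hwY : (Y *ᵥ g) ᵥ* Y = α ^ 2 • g := by
    rw [← mulVec_transpose, hskew, neg_mulVec, hYYg, neg_smul, neg_neg]
  have hc : g ⬝ᵥ g ≠ 0 := fun h => hg0 (dotProduct_self_eq_zero.1 h)
  set w := Y *ᵥ g with hw
  have hwg : w ⬝ᵥ g = 0 := by rw [dotProduct_comm, hgw]
  set c := g ⬝ᵥ g with hcdef
  set P : Matrix (Fin k) (Fin k) ℝ := c⁻¹ • vecMulVec g g + (α ^ 2 * c)⁻¹ • vecMulVec w w with hP
  have hPv (v : Fin k → ℝ) :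
      P *ᵥ v = (c⁻¹ * (g ⬝ᵥ v)) • g + ((α ^ 2 * c)⁻¹ * (w ⬝ᵥ v)) • w := by
    simp [hP, add_mulVec, smul_mulVec, vecMulVec_mulVec, smul_smul]
  have hPt : Pᵀ = P := by simp [hP, transpose_vecMulVec]
  have hPP : P * P = P := by
    have h1 : P * vecMulVec g g = vecMulVec g g := by
      rw [mul_vecMulVec, hPv, hwg, ← hcdef, inv_mul_cancel₀ hc]; simp
    have h2 : P * vecMulVec w w = vecMulVec w w := by
      rw [mul_vecMulVec, hPv, hgw, hww, inv_mul_cancel₀ (by positivity)]; simp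
    nth_rewrite 2 [hP]
    rw [mul_add, Matrix.mul_smul, Matrix.mul_smul, h1, h2]
  have hPY : P * Y = Y * P := by
    rw [hP, mul_add, add_mul, Matrix.mul_smul, Matrix.mul_smul, Matrix.smul_mul,
      Matrix.smul_mul, vecMulVec_mul,
      vecMulVec_mul, mul_vecMulVec, mul_vecMulVec, hgY, hwY, ← hw, hYYg]
    ext i j
    simp [vecMulVec_apply]
    field_simp
    ring
  have hMM : (1 - 2 • P) * (1 - 2 • P) = 1 := by
    have : (1 - 2 • P) * (1 - 2 • P) = 1 - 4 • P + 4 • (P * P) := by noncomm_ring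
    rw [this, hPP, sub_add_cancel]
  have hMt : (1 - 2 • P : Matrix (Fin k) (Fin k) ℝ)ᵀ = 1 - 2 • P := by
    rw [transpose_sub, transpose_smul, hPt, transpose_one]
  have hfix (v : Fin k → ℝ) (h1 : g ⬝ᵥ v = 0) (h2 : w ⬝ᵥ v = 0) : (1 - 2 • P) *ᵥ v = v := by
    rw [sub_mulVec, smul_mulVec, hPv, h1, h2]
    simp
  refine ⟨hskew, hY, 1 - 2 • P, ?_, ?_, ?_, ?_, ?_⟩
  · rw [hMt, hMM]
  · intro h
    have h2 := congrArg (· *ᵥ g) (sub_eq_self.1 h)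
    rw [smul_mulVec, hPv, hwg, ← hcdef, inv_mul_cancel₀ hc, zero_mulVec] at h2
    exact hg0 (funext fun i => by simpa using congrFun h2 i)
  · exact hfix x (dotProduct_comm x g ▸ hxg) (dotProduct_comm x w ▸ hxYg)
  · have : (1 - 2 • P) * Y = Y * (1 - 2 • P) := by
      rw [sub_mul, mul_sub, Matrix.smul_mul, Matrix.mul_smul, hPY, one_mul, mul_one]
    rw [hMt, this, mul_assoc, hMM, mul_one]
  · intro v hv
    have hwv : w ⬝ᵥ v = 0 := by
      rw [hw, mulVec_dotProduct_of_skew hskew, hv, dotProduct_zero, neg_zero]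
    refine hfix v ?_ hwv
    have h1 := mulVec_dotProduct_of_skew hskew w v
    rw [hv, hYYg, dotProduct_zero, neg_zero, smul_dotProduct, smul_eq_mul] at h1
    exact (mul_eq_zero.1 h1).resolve_left (by simpa using hα.ne')

end SpectralCharacterization

/-- Spectral characterization of `C_k`: for skew-symmetric `Y ≠ 0`, the point `(x,Y)` lies in
`C_k` iff for some `α > 0` the eigenspace `E_α = ker(Y² + α² I)` is nonzero and either the
orthogonal projection of `x` onto `E_α` vanishes (i.e. `x ⊥ E_α`), or `dim E_α ≥ 4`. -/
theorem mem_Cset_iff_spectral (k : ℕ) (hk : 2 ≤ k) (x : Fin k → ℝ)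
    (Y : Matrix (Fin k) (Fin k) ℝ) (hskew : Yᵀ = -Y) (hY : Y ≠ 0) :
    (x, Y) ∈ Cset k ↔ ∃ α : ℝ, 0 < α ∧ eigSpace Y α ≠ ⊥ ∧
      ((∀ v ∈ eigSpace Y α, x ⬝ᵥ v = 0) ∨ 4 ≤ Module.finrank ℝ (eigSpace Y α)) := by
  constructor
  · intro h
    obtain ⟨α, hα, g, hg, hg0, hxg, hxYg⟩ := exists_mem_eigSpace_of_mem_Cset h
    refine ⟨α, hα, (Submodule.ne_bot_iff _).2 ⟨g, hg, hg0⟩, or_iff_not_imp_left.2 fun hx => ?_⟩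
    push Not at hx
    obtain ⟨v, hv, hxv⟩ := hx
    have hgw := dotProduct_mulVec_self_of_skew hskew g
    have hwg := dotProduct_comm g (Y *ᵥ g) ▸ hgw
    have hYg := mulVec_mem_eigSpace hg
    have hc : g ⬝ᵥ g ≠ 0 := fun h => hg0 (dotProduct_self_eq_zero.1 h)
    have hd : Y *ᵥ g ⬝ᵥ Y *ᵥ g ≠ 0 := fun h =>
      mulVec_ne_zero_of_mem_eigSpace hα hg hg0 (dotProduct_self_eq_zero.1 h)
    refine four_le_finrank_eigSpace hskew hα hg
      (v := v - ((v ⬝ᵥ g) / (g ⬝ᵥ g)) • g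
        - ((v ⬝ᵥ Y *ᵥ g) / (Y *ᵥ g ⬝ᵥ Y *ᵥ g)) • (Y *ᵥ g))
      (Submodule.sub_mem _ (Submodule.sub_mem _ hv (Submodule.smul_mem _ _ hg))
        (Submodule.smul_mem _ _ hYg)) hg0 ?_ ?_ ?_
    · intro h0
      apply hxv
      simpa [dotProduct_sub, dotProduct_smul, hxg, hxYg] using congrArg (x ⬝ᵥ ·) h0
    · simp [sub_dotProduct, smul_dotProduct, hwg, hc]
    · simp [sub_dotProduct, smul_dotProduct, hgw, hd]
  · rintro ⟨α, hα, hne, hx | hdim⟩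
    · obtain ⟨g, hg, hg0⟩ := (Submodule.ne_bot_iff _).1 hne
      exact mem_Cset_of_mem_eigSpace hskew hY hα hg hg0 (hx g hg) (hx _ (mulVec_mem_eigSpace hg))
    · let φ : (Fin k → ℝ) →ₗ[ℝ] ℝ × ℝ :=
        (dotProductBilin ℝ ℝ x).prod ((dotProductBilin ℝ ℝ x).comp Y.mulVecLin)
      have hlt : Module.finrank ℝ (ℝ × ℝ) < Module.finrank ℝ (eigSpace Y α) := by
        rw [Module.finrank_prod, Module.finrank_self]
        omega
      obtain ⟨⟨g, hg⟩, hgker, hg0⟩ := (Submodule.ne_bot_iff _).1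
        (LinearMap.ker_ne_bot_of_finrank_lt (f := φ.domRestrict (eigSpace Y α)) hlt)
      have hφ : φ g = 0 := hgker
      exact mem_Cset_of_mem_eigSpace hskew hY hα hg (fun h => hg0 (Subtype.ext h))
        (congrArg Prod.fst hφ) (congrArg Prod.snd hφ)
end
end

section
/- Let x : [0,1] → ℝ^k be a continuously differentiable curve with x(0) = 0, and define Y(t) := (1/2) ∫₀ᵗ ( x(s) ẋ(s)ᵀ − ẋ(s) x(s)ᵀ ) ds, a skew-symmetric matrix for each t. If M ∈ O(k) satisfies M x(t) = x(t) for all t ∈ [0,1] and M v = v for every v ∈ ker Y(1), then M is the identity matrix. -/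
open Matrix Set

noncomputable section

/-- The vertical (skew-symmetric) component `Y(t) = ½ ∫₀ᵗ (x ẋᵀ − ẋ xᵀ) ds` of the horizontal
lift of a curve `x` with derivative `x'`. -/
def pathY {k : ℕ} (x x' : ℝ → Fin k → ℝ) (t : ℝ) : Matrix (Fin k) (Fin k) ℝ :=
  Matrix.of fun i j => (1 / 2 : ℝ) * ∫ s in (0:ℝ)..t, (x s i * x' s j - x' s i * x s j)

theorem pathY_transpose {k : ℕ} (x x' : ℝ → Fin k → ℝ) (t : ℝ) :
    (pathY x x' t)ᵀ = -pathY x x' t := by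
  ext i j
  simp only [pathY, transpose_apply, Matrix.neg_apply, of_apply]
  rw [← mul_neg, ← intervalIntegral.integral_neg]
  congr 2
  ext s
  ring

/-- A matrix annihilating a curve also annihilates its derivative. -/
theorem mulVec_deriv_eq_zero {m k : ℕ} {x : ℝ → Fin k → ℝ} {v : Fin k → ℝ} {s : Set ℝ} {t : ℝ}
    (hs : UniqueDiffWithinAt ℝ s t) (ht : t ∈ s) (hderiv : HasDerivWithinAt x v s t)
    (N : Matrix (Fin m) (Fin k) ℝ) (hN : ∀ r ∈ s, N *ᵥ x r = 0) : N *ᵥ v = 0 := by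
  have h := (LinearMap.toContinuousLinearMap N.mulVecLin).hasFDerivAt.comp_hasDerivWithinAt t hderiv
  exact hs.eq_deriv s h ((hasDerivWithinAt_const t s 0).congr hN (hN t ht))

theorem mul_pathY_eq_zero {k : ℕ} {x x' : ℝ → Fin k → ℝ} {t : ℝ} (ht : 0 ≤ t)
    (hx : ContinuousOn x (Icc 0 t)) (hx' : ContinuousOn x' (Icc 0 t))
    (N : Matrix (Fin k) (Fin k) ℝ) (hN : ∀ s ∈ Icc 0 t, N *ᵥ x s = 0)
    (hN' : ∀ s ∈ Icc 0 t, N *ᵥ x' s = 0) : N * pathY x x' t = 0 := by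
  rw [← uIcc_of_le ht] at hx hx' hN hN'
  rw [continuousOn_pi] at hx hx'
  ext i j
  simp only [pathY, mul_apply, of_apply, Matrix.zero_apply, mul_left_comm (N i _)]
  rw [← Finset.mul_sum]
  simp only [← intervalIntegral.integral_const_mul]
  rw [← intervalIntegral.integral_finsetSum fun l _ => ContinuousOn.intervalIntegrable
      (by fun_prop),
    intervalIntegral.integral_congr (g := fun _ => 0)]
  · simp
  · intro s hs
    have h := congrFun (hN s hs) i
    have h' := congrFun (hN' s hs) i
    simp only [mulVec, dotProduct, Pi.zero_apply] at h h'
    simp only [mul_sub, ← mul_assoc, Finset.sum_sub_distrib, ← Finset.sum_mul, h, h', zero_mul,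
      sub_zero]

/-- A matrix vanishing on both the range and the kernel of a skew-symmetric matrix is zero. -/
theorem eq_zero_of_mul_skew_eq_zero {k : ℕ} {N Y : Matrix (Fin k) (Fin k) ℝ} (hY : Yᵀ = -Y)
    (hmul : N * Y = 0) (hker : ∀ v, Y *ᵥ v = 0 → N *ᵥ v = 0) : N = 0 := by
  have hYN : Y * Nᵀ = 0 := by
    have h := congrArg transpose hmul
    rwa [transpose_mul, hY, neg_mul, transpose_zero, neg_eq_zero] at h
  refine funext fun i => (show N i = 0 from ?_)
  refine dotProduct_self_eq_zero.mp ?_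
  have h : Y *ᵥ N i = 0 := funext fun j => congrFun (congrFun hYN j) i
  exact congrFun (hker _ h) i

/-- If `x : [0,1] → ℝᵏ` is a C¹ curve with `x(0) = 0`, `Y(t) = ½ ∫₀ᵗ (x ẋᵀ − ẋ xᵀ) ds`, and
`M` is an orthogonal matrix fixing `x(t)` for all `t ∈ [0,1]` and fixing `ker Y(1)` pointwise,
then `M` is the identity. -/
theorem orthogonal_fixing_curve_and_kernel_eq_one
    (k : ℕ) (hk : 2 ≤ k) (x x' : ℝ → Fin k → ℝ)
    (hx0 : x 0 = 0)
    (hderiv : ∀ t ∈ Icc (0:ℝ) 1, HasDerivWithinAt x (x' t) (Icc (0:ℝ) 1) t)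
    (hcont : ContinuousOn x' (Icc (0:ℝ) 1))
    (M : Matrix (Fin k) (Fin k) ℝ) (horth : M * Mᵀ = 1)
    (hfix : ∀ t ∈ Icc (0:ℝ) 1, M.mulVec (x t) = x t)
    (hker : ∀ v : Fin k → ℝ, (pathY x x' 1).mulVec v = 0 → M.mulVec v = v) :
    M = 1 := by
  have hfix' : ∀ t ∈ Icc (0:ℝ) 1, (M - 1) *ᵥ x t = 0 := fun t ht => by
    rw [sub_mulVec, one_mulVec, hfix t ht, sub_self]
  refine sub_eq_zero.mp (eq_zero_of_mul_skew_eq_zero (pathY_transpose x x' 1) ?_ fun v hv => by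
    rw [sub_mulVec, one_mulVec, hker v hv, sub_self])
  exact mul_pathY_eq_zero zero_le_one (fun t ht => (hderiv t ht).continuousWithinAt) hcont _ hfix'
    fun t ht => mulVec_deriv_eq_zero (uniqueDiffOn_Icc zero_lt_one t ht) ht (hderiv t ht) _ hfix'
end
end

section
/- Let x : [0,1] → ℝ^k be continuously differentiable with x(0) = 0, set Y(t) := (1/2) ∫₀ᵗ ( x(s) ẋ(s)ᵀ − ẋ(s) x(s)ᵀ ) ds, and suppose the endpoint (x(1), Y(1)) lies in C_k. For M ∈ 𝓜(x(1),Y(1)), let γ_M denote the curve t ↦ (M x(t), M Y(t) Mᵀ). Then: (i) each γ_M has the same initial point (0,0) and the same endpoint (x(1),Y(1)) as γ_1; (ii) M Y(t) Mᵀ = (1/2) ∫₀ᵗ ( (Mx)(s) (Mẋ)(s)ᵀ − (Mẋ)(s) (Mx)(s)ᵀ ) ds and ∫₀¹ |M ẋ(t)| dt = ∫₀¹ |ẋ(t)| dt, so each γ_M is a curve of the same type and length; and (iii) the map M ↦ γ_M is injective on 𝓜(x(1),Y(1)), so distinct elements of 𝓜(x(1),Y(1)) give mutually distinct curves. -/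
open Matrix Set

noncomputable section

/-- The stabilizer group `𝓜(x,Y)` of orthogonal matrices fixing `x`, stabilizing `Y`, and
fixing `ker Y` pointwise (the identity matrix belongs to it). -/
def stab {k : ℕ} (x : Fin k → ℝ) (Y : Matrix (Fin k) (Fin k) ℝ) :
    Set (Matrix (Fin k) (Fin k) ℝ) :=
  {M | M * Mᵀ = 1 ∧ M.mulVec x = x ∧ M * Y * Mᵀ = Y ∧
    ∀ v : Fin k → ℝ, Y.mulVec v = 0 → M.mulVec v = v}

/-- The bilinear transformation rule for the vertical component: `A Y(t) Bᵀ` is obtained by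
applying `A` and `B` under the integral sign. -/
theorem mul_pathY_mul_transpose_apply {k : ℕ} {x x' : ℝ → Fin k → ℝ} {t : ℝ}
    (hx : ContinuousOn x (uIcc 0 t)) (hx' : ContinuousOn x' (uIcc 0 t))
    (A B : Matrix (Fin k) (Fin k) ℝ) (i j : Fin k) :
    (A * pathY x x' t * Bᵀ) i j = (1 / 2 : ℝ) * ∫ s in (0:ℝ)..t,
      ((A *ᵥ x s) i * (B *ᵥ x' s) j - (A *ᵥ x' s) i * (B *ᵥ x s) j) := by
  have hxi (a : Fin k) : ContinuousOn (fun s => x s a) (uIcc 0 t) := continuousOn_pi.1 hx a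
  have hxi' (a : Fin k) : ContinuousOn (fun s => x' s a) (uIcc 0 t) := continuousOn_pi.1 hx' a
  have hterm (a b : Fin k) : ContinuousOn
      (fun s => A i a * B j b * (x s a * x' s b - x' s a * x s b)) (uIcc 0 t) :=
    continuousOn_const.mul (((hxi a).mul (hxi' b)).sub ((hxi' a).mul (hxi b)))
  have hsum (s : ℝ) : (A *ᵥ x s) i * (B *ᵥ x' s) j - (A *ᵥ x' s) i * (B *ᵥ x s) j =
      ∑ b, ∑ a, A i a * B j b * (x s a * x' s b - x' s a * x s b) := by
    simp only [mulVec, dotProduct, Finset.sum_mul_sum]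
    simp only [← Finset.sum_sub_distrib]
    rw [Finset.sum_comm]
    refine Finset.sum_congr rfl fun b _ => Finset.sum_congr rfl fun a _ => ?_
    ring
  simp only [hsum]
  rw [intervalIntegral.integral_finsetSum fun b _ =>
      (continuousOn_finsetSum _ fun a _ => hterm a b).intervalIntegrable,
    Finset.mul_sum, mul_apply]
  refine Finset.sum_congr rfl fun b _ => ?_
  rw [intervalIntegral.integral_finsetSum fun a _ => (hterm a b).intervalIntegrable, Finset.mul_sum,
    mul_apply, Finset.sum_mul]
  refine Finset.sum_congr rfl fun a _ => ?_
  rw [intervalIntegral.integral_const_mul, transpose_apply, pathY, of_apply]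
  ring

/-- A matrix with orthonormal rows preserves the sum of squares of the coordinates. -/
theorem sum_mulVec_sq_of_mul_transpose_eq_one {n : Type*} [Fintype n] [DecidableEq n]
    {M : Matrix n n ℝ} (hM : M * Mᵀ = 1) (v : n → ℝ) :
    ∑ i, (M *ᵥ v) i ^ 2 = ∑ i, v i ^ 2 := by
  have h : (M *ᵥ v) ⬝ᵥ (M *ᵥ v) = v ⬝ᵥ v := by
    rw [dotProduct_mulVec, ← mulVec_transpose, mulVec_mulVec, mul_eq_one_comm.1 hM, one_mulVec]
  simpa only [dotProduct, ← sq] using h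

/-- A matrix annihilating a differentiable curve on `[0, 1]` annihilates its derivative there. -/
theorem mulVec_deriv_eq_zero_s7 {k : ℕ} {x x' : ℝ → Fin k → ℝ}
    (hderiv : ∀ t ∈ Icc (0:ℝ) 1, HasDerivWithinAt x (x' t) (Icc (0:ℝ) 1) t)
    {D : Matrix (Fin k) (Fin k) ℝ} (hD : ∀ t ∈ Icc (0:ℝ) 1, D *ᵥ x t = 0) :
    ∀ t ∈ Icc (0:ℝ) 1, D *ᵥ x' t = 0 := by
  intro t ht
  have h : HasDerivWithinAt (fun s => D *ᵥ x s) (D *ᵥ x' t) (Icc (0:ℝ) 1) t :=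
    (LinearMap.toContinuousLinearMap D.mulVecLin).hasFDerivAt.comp_hasDerivWithinAt t
      (hderiv t ht)
  have h₀ : HasDerivWithinAt (fun s => D *ᵥ x s) 0 (Icc (0:ℝ) 1) t :=
    (hasDerivWithinAt_const t _ (0 : Fin k → ℝ)).congr hD (hD t ht)
  exact (uniqueDiffOn_Icc one_pos t ht).eq_deriv _ h h₀

/-- If `D` has its rows in the kernel of a skew-symmetric `Y`, and annihilates that kernel,
then `D = 0`. -/
theorem eq_zero_of_mul_eq_zero_of_ker {n : Type*} [Fintype n] {D Y : Matrix n n ℝ}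
    (hY : Yᵀ = -Y) (hDY : D * Y = 0) (hker : ∀ v, Y *ᵥ v = 0 → D *ᵥ v = 0) : D = 0 := by
  ext i j
  have hrow : Y *ᵥ D i = 0 := by
    have h : D i ᵥ* Y = 0 := congrFun hDY i
    rwa [← mulVec_transpose, hY, neg_mulVec, neg_eq_zero] at h
  have h : D i ⬝ᵥ D i = 0 := congrFun (hker _ hrow) i
  exact congrFun (dotProduct_self_eq_zero.1 h) j

/-- Let `x : [0,1] → ℝᵏ` be C¹ with `x(0) = 0` and `Y(t) = ½∫₀ᵗ (x ẋᵀ − ẋ xᵀ)`, with endpoint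
`(x(1),Y(1)) ∈ C_k`. For `M ∈ 𝓜(x(1),Y(1))` let `γ_M(t) = (M x(t), M Y(t) Mᵀ)`. Then:
(i) every `γ_M` starts at `(0,0)` and ends at `(x(1),Y(1))`;
(ii) `M Y(t) Mᵀ` is the vertical component of the curve `M x(t)`, and the length of `M x`
equals that of `x`; and
(iii) the map `M ↦ γ_M` is injective on `𝓜(x(1),Y(1))`. -/
theorem stabilizer_family_of_geodesics
    (k : ℕ) (hk : 2 ≤ k) (x x' : ℝ → Fin k → ℝ)
    (hx0 : x 0 = 0)
    (hderiv : ∀ t ∈ Icc (0:ℝ) 1, HasDerivWithinAt x (x' t) (Icc (0:ℝ) 1) t)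
    (hcont : ContinuousOn x' (Icc (0:ℝ) 1))
    (hC : (x 1, pathY x x' 1) ∈ Cset k) :
    (∀ M ∈ stab (x 1) (pathY x x' 1),
      (M.mulVec (x 0), M * pathY x x' 0 * Mᵀ) =
        ((0 : Fin k → ℝ), (0 : Matrix (Fin k) (Fin k) ℝ)) ∧
      (M.mulVec (x 1), M * pathY x x' 1 * Mᵀ) = (x 1, pathY x x' 1)) ∧
    (∀ M ∈ stab (x 1) (pathY x x' 1),
      (∀ t ∈ Icc (0:ℝ) 1,
        M * pathY x x' t * Mᵀ =
          pathY (fun s => M.mulVec (x s)) (fun s => M.mulVec (x' s)) t) ∧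
      (∫ t in (0:ℝ)..1, Real.sqrt (∑ i, (M.mulVec (x' t) i) ^ 2)) =
        ∫ t in (0:ℝ)..1, Real.sqrt (∑ i, (x' t i) ^ 2)) ∧
    (∀ M₁ ∈ stab (x 1) (pathY x x' 1), ∀ M₂ ∈ stab (x 1) (pathY x x' 1),
      (∀ t ∈ Icc (0:ℝ) 1,
        (M₁.mulVec (x t), M₁ * pathY x x' t * M₁ᵀ) =
          (M₂.mulVec (x t), M₂ * pathY x x' t * M₂ᵀ)) → M₁ = M₂) := by
  have hxc : ContinuousOn x (Icc 0 1) := fun t ht => (hderiv t ht).continuousWithinAt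
  have hsub {t : ℝ} (ht : t ∈ Icc (0:ℝ) 1) : uIcc 0 t ⊆ Icc 0 1 := by
    rw [uIcc_of_le ht.1]
    exact Icc_subset_Icc_right ht.2
  have htrans {t : ℝ} (ht : t ∈ Icc (0:ℝ) 1) :=
    mul_pathY_mul_transpose_apply (hxc.mono (hsub ht)) (hcont.mono (hsub ht))
  have hY0 : pathY x x' 0 = 0 := by
    ext i j
    simp [pathY]
  refine ⟨fun M hM => ⟨?_, ?_⟩, fun M hM => ⟨fun t ht => ?_, ?_⟩, fun M₁ h₁ M₂ h₂ h => ?_⟩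
  · simp [hx0, hY0]
  · rw [hM.2.1, hM.2.2.1]
  · ext i j
    rw [htrans ht, pathY, of_apply]
  · simp only [sum_mulVec_sq_of_mul_transpose_eq_one hM.1]
  · have hD : ∀ t ∈ Icc (0:ℝ) 1, (M₁ - M₂) *ᵥ x t = 0 := fun t ht => by
      rw [sub_mulVec, (Prod.mk.inj (h t ht)).1, sub_self]
    have hD' := mulVec_deriv_eq_zero_s7 hderiv hD
    have h1 : (1:ℝ) ∈ Icc (0:ℝ) 1 := right_mem_Icc.2 zero_le_one
    refine sub_eq_zero.1 (eq_zero_of_mul_eq_zero_of_ker hC.1 ?_ fun v hv => ?_)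
    · ext i j
      have hint := htrans h1 (M₁ - M₂) 1 i j
      rw [transpose_one, mul_one] at hint
      rw [hint, intervalIntegral.integral_congr (g := fun _ => (0:ℝ)) fun s hs => ?_]
      · simp
      · simp [hD s (hsub h1 hs), hD' s (hsub h1 hs)]
    · rw [sub_mulVec, h₁.2.2.2 v hv, h₂.2.2.2 v hv, sub_self]
end
end

section
/- Let Y be a real skew-symmetric k×k matrix of rank 2r and x ∈ ℝ^k with Y x = 0. Then the set of all vectors of the form d/dt|_{t=0} ( Y(t) x(t) ), where t ↦ Y(t) is a differentiable curve of skew-symmetric matrices with Y(0) = Y and rank Y(t) = 2r for all t near 0, and t ↦ x(t) is a differentiable curve in ℝ^k with x(0) = x, equals exactly the column space of Y (a subspace of dimension 2r). In particular, every such derivative lies in range Y and every element of range Y is so realized. -/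
open Matrix

noncomputable section

open Filter Topology

/-- If `A t` is differentiable at `0` and its rank near `0` is at most the rank of `A 0`, then the
derivative maps the kernel of `A 0` into the range of `A 0`. -/
theorem deriv_mulVec_mem_range_of_rank_le {m n : Type*} [Fintype m] [Fintype n]
    (A : ℝ → Matrix m n ℝ) (A' : Matrix m n ℝ) (x : n → ℝ) (hx : A 0 *ᵥ x = 0)
    (hA : ∀ i j, HasDerivAt (fun t => A t i j) (A' i j) 0)
    (hrank : ∀ᶠ t in 𝓝 0, (A t).rank ≤ (A 0).rank) :
    A' *ᵥ x ∈ LinearMap.range (A 0).mulVecLin := by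
  by_contra hnot
  obtain ⟨d, hd⟩ : ∃ d, (A 0).rank = d := ⟨_, rfl⟩
  let b := Module.finBasisOfFinrankEq ℝ (LinearMap.range (A 0).mulVecLin) hd
  choose u hu using fun i => (b i).2
  have hb : LinearIndependent ℝ (fun i => A 0 *ᵥ u i) := by
    have hval : (fun i => A 0 *ᵥ u i) = (LinearMap.range (A 0).mulVecLin).subtype ∘ b :=
      funext hu
    rw [hval]
    exact b.linearIndependent.map' _ (Submodule.ker_subtype _)
  have hli : LinearIndependent ℝ
      (fun o : Option (Fin d) => o.elim (A' *ᵥ x) (fun i => A 0 *ᵥ u i)) := by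
    refine linearIndependent_option.2 ⟨hb, fun hmem => hnot (Submodule.span_le.2 ?_ hmem)⟩
    rintro _ ⟨i, rfl⟩
    exact ⟨u i, rfl⟩
  have hcol (v : n → ℝ) : Tendsto (fun t => A t *ᵥ v) (𝓝[≠] 0) (𝓝 (A 0 *ᵥ v)) := by
    refine tendsto_pi_nhds.2 fun i => ?_
    refine tendsto_finsetSum _ fun j _ => ?_
    exact ((hA i j).continuousAt.tendsto.mono_left nhdsWithin_le_nhds).mul_const _
  have hquot : Tendsto (fun t => A t *ᵥ (t⁻¹ • x)) (𝓝[≠] 0) (𝓝 (A' *ᵥ x)) := by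
    refine tendsto_pi_nhds.2 fun i => ?_
    have hd : HasDerivAt (fun t => (A t *ᵥ x) i) ((A' *ᵥ x) i) 0 :=
      HasDerivAt.fun_sum fun j _ => (hA i j).mul_const (x j)
    refine (hasDerivAt_iff_tendsto_slope_zero.1 hd).congr fun t => ?_
    simp [hx, mulVec_smul]
  have hev : ∀ᶠ t in 𝓝[≠] 0, LinearIndependent ℝ
      (fun o : Option (Fin d) => o.elim (A t *ᵥ (t⁻¹ • x)) (fun i => A t *ᵥ u i)) := by
    refine Tendsto.eventually_mem ?_ (isOpen_setOfPred_linearIndependent.mem_nhds hli)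
    refine tendsto_pi_nhds.2 fun o => ?_
    cases o with
    | none => exact hquot
    | some i => exact hcol (u i)
  obtain ⟨t, ht, htr⟩ := (hev.and (hrank.filter_mono nhdsWithin_le_nhds)).exists
  have hspan : Submodule.span ℝ (Set.range fun o : Option (Fin d) =>
      o.elim (A t *ᵥ (t⁻¹ • x)) (fun i => A t *ᵥ u i)) ≤ LinearMap.range (A t).mulVecLin := by
    refine Submodule.span_le.2 ?_
    rintro _ ⟨o, rfl⟩
    cases o with
    | none => exact ⟨t⁻¹ • x, rfl⟩
    | some i => exact ⟨u i, rfl⟩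
  have hle := (Submodule.finrank_mono hspan).trans htr
  rw [finrank_span_eq_card ht, Fintype.card_option, Fintype.card_fin, hd] at hle
  exact Nat.not_succ_le_self _ hle

/-- The rank claim for the map `φ(x,Y) = Yx` restricted to `ℝᵏ × S_{2r}`: for a skew-symmetric
`Y` of rank `2r` and `x` with `Yx = 0`, the set of all derivatives `d/dt|₀ (Y(t) x(t))` along
differentiable curves `Y(t)` of skew-symmetric matrices of constant rank `2r` with `Y(0) = Y`
and `x(t)` with `x(0) = x`, is exactly the column space of `Y`, which has dimension `2r`. -/
theorem derivative_set_eq_columnSpace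
    (k r : ℕ) (hk : 2 ≤ k) (hr : 1 ≤ r) (h2r : 2 * r ≤ k)
    (Y : Matrix (Fin k) (Fin k) ℝ) (hskew : Yᵀ = -Y) (hrank : Y.rank = 2 * r)
    (x : Fin k → ℝ) (hx : Y.mulVec x = 0) :
    {w : Fin k → ℝ |
      ∃ (Yc : ℝ → Matrix (Fin k) (Fin k) ℝ) (xc : ℝ → Fin k → ℝ)
        (Y' : Matrix (Fin k) (Fin k) ℝ) (x' : Fin k → ℝ) (ε : ℝ),
        Yc 0 = Y ∧ xc 0 = x ∧ (∀ t : ℝ, (Yc t)ᵀ = -(Yc t)) ∧ 0 < ε ∧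
        (∀ t : ℝ, |t| < ε → (Yc t).rank = 2 * r) ∧
        (∀ i j, HasDerivAt (fun t => Yc t i j) (Y' i j) 0) ∧
        (∀ i, HasDerivAt (fun t => xc t i) (x' i) 0) ∧
        (∀ i, HasDerivAt (fun t => (Yc t).mulVec (xc t) i) (w i) 0)} =
      (LinearMap.range Y.mulVecLin : Set (Fin k → ℝ)) ∧
    Module.finrank ℝ (LinearMap.range Y.mulVecLin) = 2 * r := by
  refine ⟨Set.Subset.antisymm ?_ ?_, hrank⟩
  · rintro w ⟨Yc, xc, Y', x', ε, rfl, rfl, -, hε, hr', hY, hxc, hw⟩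
    have hmem := deriv_mulVec_mem_range_of_rank_le Yc Y' (xc 0) hx hY <| by
      filter_upwards [Metric.ball_mem_nhds (0 : ℝ) hε] with t ht
      rw [hrank, hr' t (by simpa using ht)]
    have hsum : w = Y' *ᵥ xc 0 + Yc 0 *ᵥ x' := by
      ext i
      refine (hw i).unique ?_
      have hd := HasDerivAt.fun_sum (u := Finset.univ) fun j _ => (hY i j).mul (hxc j)
      rw [Finset.sum_add_distrib] at hd
      exact hd
    rw [hsum]
    exact Submodule.add_mem _ hmem ⟨x', rfl⟩
  · rintro _ ⟨v, rfl⟩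
    refine ⟨fun _ => Y, fun t => x + t • v, 0, v, 1, rfl, by simp, fun _ => hskew, one_pos,
      fun _ _ => hrank, fun i j => hasDerivAt_const _ _, fun i => ?_, fun i => ?_⟩
    · simpa using ((hasDerivAt_id (0 : ℝ)).mul_const (v i)).const_add (x i)
    · simpa [mulVec_add, mulVec_smul, hx] using
        (hasDerivAt_id (0 : ℝ)).mul_const ((Y *ᵥ v) i)
end
end

section
/- For every k ≥ 2, the set P_k ⊆ ℝ^k × Skew_k ≅ ℝ^{k(k+1)/2} has Hausdorff dimension 3k − 5; equivalently, its codimension in the k(k+1)/2-dimensional space is (k² − 5k + 10)/2. -/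
open Matrix
open scoped ENNReal

attribute [local instance] Matrix.normedAddCommGroup

noncomputable section

attribute [local instance] Matrix.normedSpace

/-- The indices different from both `i` and `j`. -/
abbrev OffPair {k : ℕ} (i j : Fin k) : Type := {l : Fin k // l ≠ i ∧ l ≠ j}

/-- The space of parameters of the chart of `P_k` on which `Y i j > 0`. -/
abbrev ChartParam {k : ℕ} (i j : Fin k) : Type :=
  ℝ × (OffPair i j → ℝ) × (OffPair i j → ℝ) × (OffPair i j → ℝ)

/-- The vector with entries `r` at `i`, `s` at `j` and `a` elsewhere. -/
def fillPair {k : ℕ} (i j : Fin k) (r s : ℝ) (a : OffPair i j → ℝ) : Fin k → ℝ :=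
  fun l => if h : l ≠ i ∧ l ≠ j then a ⟨l, h⟩ else if l = i then r else s

/-- A point of `P_k` expressed through the entry `t = Y i j`, the remaining entries of the rows
`i` and `j` of `Y`, and the coordinates of `x` outside `{i, j}`. -/
def chart {k : ℕ} (i j : Fin k) (p : ChartParam i j) :
    (Fin k → ℝ) × Matrix (Fin k) (Fin k) ℝ :=
  (fillPair i j (p.1⁻¹ * ∑ l, p.2.2.1 l * p.2.2.2 l) (-(p.1⁻¹ * ∑ l, p.2.1 l * p.2.2.2 l)) p.2.2.2,
    p.1⁻¹ • wedge (fillPair i j 0 p.1 p.2.1) (fillPair i j (-p.1) 0 p.2.2.1))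

/-- The coordinates of a point of `P_k` in the chart `chart i j`. -/
def chartCoord {k : ℕ} (i j : Fin k) (q : (Fin k → ℝ) × Matrix (Fin k) (Fin k) ℝ) :
    ChartParam i j :=
  (q.2 i j, fun l => q.2 i l, fun l => q.2 j l, fun l => q.1 l)

section

variable {k : ℕ} {i j : Fin k}

lemma wedge_apply (v w : Fin k → ℝ) (a b : Fin k) : wedge v w a b = v a * w b - w a * v b := by
  simp [wedge, vecMulVec_apply]

lemma wedge_transpose (v w : Fin k → ℝ) : (wedge v w)ᵀ = -wedge v w := by
  ext a b
  simp only [transpose_apply, Matrix.neg_apply, wedge_apply]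
  ring

lemma wedge_mulVec (v w x : Fin k → ℝ) :
    (wedge v w).mulVec x = (w ⬝ᵥ x) • v - (v ⬝ᵥ x) • w := by
  ext a
  simp only [mulVec, dotProduct, wedge_apply, Pi.sub_apply, Pi.smul_apply, smul_eq_mul,
    Finset.sum_mul, ← Finset.sum_sub_distrib]
  exact Finset.sum_congr rfl fun b _ => by ring

lemma fillPair_left (r s : ℝ) (a : OffPair i j → ℝ) : fillPair i j r s a i = r := by
  simp [fillPair]

lemma fillPair_right (hij : i ≠ j) (r s : ℝ) (a : OffPair i j → ℝ) :
    fillPair i j r s a j = s := by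
  simp [fillPair, hij.symm]

lemma fillPair_coe (r s : ℝ) (a : OffPair i j → ℝ) (l : OffPair i j) :
    fillPair i j r s a l = a l := by
  simp only [fillPair, dif_pos l.2]

lemma fillPair_restrict (hij : i ≠ j) (v : Fin k → ℝ) :
    fillPair i j (v i) (v j) (fun l => v l) = v := by
  ext l
  by_cases hi : l = i
  · subst hi; exact fillPair_left ..
  by_cases hj : l = j
  · subst hj; exact fillPair_right hij ..
  exact fillPair_coe _ _ _ ⟨l, hi, hj⟩

lemma sum_eq_add_sum_offPair (hij : i ≠ j) (f : Fin k → ℝ) :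
    ∑ l, f l = f i + f j + ∑ l : OffPair i j, f l := by
  rw [← Finset.sum_subtype (Finset.univ \ {i, j}) (by simp) f,
    ← Finset.sum_sdiff (Finset.subset_univ {i, j}), Finset.sum_pair hij, add_comm]

lemma card_offPair (hij : i ≠ j) : Fintype.card (OffPair i j) = k - 2 := by
  rw [Fintype.card_of_subtype (Finset.univ \ {i, j}) (by simp),
    Finset.card_sdiff_of_subset (Finset.subset_univ _), Finset.card_pair hij]
  simp

lemma finrank_chartParam (hk : 2 ≤ k) (hij : i ≠ j) :
    Module.finrank ℝ (ChartParam i j) = 3 * k - 5 := by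
  simp only [Module.finrank_prod, Module.finrank_self, Module.finrank_fintype_fun_eq_card,
    card_offPair hij]
  omega

lemma fillPair_dotProduct (hij : i ≠ j) (r s r' s' : ℝ) (a b : OffPair i j → ℝ) :
    fillPair i j r s a ⬝ᵥ fillPair i j r' s' b = r * r' + s * s' + ∑ l, a l * b l := by
  rw [dotProduct, sum_eq_add_sum_offPair hij]
  simp only [fillPair_left, fillPair_right hij, fillPair_coe]

lemma chart_mem_Pset (hij : i ≠ j) {p : ChartParam i j} (hp : p.1 ≠ 0) :
    chart i j p ∈ Pset k := by
  refine ⟨?_, ⟨p.1⁻¹ • fillPair i j 0 p.1 p.2.1, fillPair i j (-p.1) 0 p.2.2.1, ?_⟩, ?_, ?_⟩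
  · simp only [chart, transpose_smul, wedge_transpose, smul_neg]
  · ext a b
    simp only [chart, Matrix.smul_apply, wedge_apply, Pi.smul_apply, smul_eq_mul]
    ring
  · intro h
    have := congrFun (congrFun h i) j
    simp [chart, wedge_apply, fillPair_left, fillPair_right hij, hp] at this
  · simp only [chart, smul_mulVec, wedge_mulVec, fillPair_dotProduct hij]
    field_simp
    simp

lemma chartCoord_chart (hij : i ≠ j) {p : ChartParam i j} (hp : p.1 ≠ 0) :
    chartCoord i j (chart i j p) = p := by
  obtain ⟨t, a, b, c⟩ := p
  change t ≠ 0 at hp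
  simp [chartCoord, chart, wedge_apply, fillPair_left, fillPair_right hij, fillPair_coe, hp]

lemma chart_chartCoord (hij : i ≠ j) {q : (Fin k → ℝ) × Matrix (Fin k) (Fin k) ℝ}
    (hq : q ∈ Pset k) (h : q.2 i j ≠ 0) : chart i j (chartCoord i j q) = q := by
  obtain ⟨x, Y⟩ := q
  obtain ⟨-, ⟨v, w, hY⟩, -, hx⟩ := hq
  dsimp only at hY hx h
  have hrow (a : Fin k) : Y a i * x i + Y a j * x j + ∑ l : OffPair i j, Y a l * x l = 0 := by
    rw [← sum_eq_add_sum_offPair hij fun l => Y a l * x l]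
    exact congrFun hx a
  have hdiag (a : Fin k) : Y a a = 0 := by rw [hY, wedge_apply]; ring
  have hskew : Y j i = -Y i j := by rw [hY, wedge_apply, wedge_apply]; ring
  have hxi : (Y i j)⁻¹ * ∑ l : OffPair i j, Y j l * x l = x i := by
    have := hrow j
    rw [hdiag, hskew] at this
    field_simp
    linarith
  have hxj : -((Y i j)⁻¹ * ∑ l : OffPair i j, Y i l * x l) = x j := by
    have := hrow i
    rw [hdiag] at this
    field_simp
    linarith
  have hi : fillPair i j 0 (Y i j) (fun l => Y i l) = Y i := by
    rw [← hdiag i]; exact fillPair_restrict hij (Y i)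
  have hj : fillPair i j (-Y i j) 0 (fun l => Y j l) = Y j := by
    rw [← hdiag j, ← hskew]; exact fillPair_restrict hij (Y j)
  simp only [chart, chartCoord, hxi, hxj, hi, hj, fillPair_restrict hij]
  congr 1
  ext a b
  rw [Matrix.smul_apply, wedge_apply, smul_eq_mul, inv_mul_eq_iff_eq_mul₀ h]
  simp only [hY, wedge_apply]
  ring

lemma contDiffOn_fillPair {E : Type*} [NormedAddCommGroup E] [NormedSpace ℝ E] {s : Set E}
    {f g : E → ℝ} {a : E → OffPair i j → ℝ} (hf : ContDiffOn ℝ 1 f s) (hg : ContDiffOn ℝ 1 g s)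
    (ha : ContDiffOn ℝ 1 a s) : ContDiffOn ℝ 1 (fun p => fillPair i j (f p) (g p) (a p)) s := by
  rw [contDiffOn_pi] at ha ⊢
  intro l
  unfold fillPair
  split_ifs
  exacts [ha _, hf, hg]

lemma contDiffOn_chart : ContDiffOn ℝ 1 (chart i j) {p | 0 < p.1} := by
  have ht : ContDiffOn ℝ 1 (fun p : ChartParam i j => p.1⁻¹) {p | 0 < p.1} :=
    contDiffOn_fst.inv fun p hp => ne_of_gt hp
  have ha : ContDiffOn ℝ 1 (fun p : ChartParam i j => p.2.1) {p | 0 < p.1} := by fun_prop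
  have hb : ContDiffOn ℝ 1 (fun p : ChartParam i j => p.2.2.1) {p | 0 < p.1} := by fun_prop
  have hc : ContDiffOn ℝ 1 (fun p : ChartParam i j => p.2.2.2) {p | 0 < p.1} := by fun_prop
  have hu := contDiffOn_pi.1 (contDiffOn_fillPair (contDiffOn_const (c := 0)) contDiffOn_fst ha)
  have hw := contDiffOn_pi.1 (contDiffOn_fillPair contDiffOn_fst.neg (contDiffOn_const (c := 0)) hb)
  refine ContDiffOn.prodMk (contDiffOn_fillPair ?_ ?_ hc) ?_
  · exact ht.mul (ContDiffOn.sum fun l _ => (contDiffOn_pi.1 hb l).mul (contDiffOn_pi.1 hc l))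
  · exact (ht.mul
      (ContDiffOn.sum fun l _ => (contDiffOn_pi.1 ha l).mul (contDiffOn_pi.1 hc l))).neg
  · refine contDiffOn_pi.2 fun a => contDiffOn_pi.2 fun b => ?_
    simp only [Matrix.smul_apply, wedge_apply, smul_eq_mul]
    exact ht.mul (((hu a).mul (hw b)).sub ((hw a).mul (hu b)))

lemma contDiff_chartCoord : ContDiff ℝ 1 (chartCoord i j) := by
  have hY (a b : Fin k) :
      ContDiff ℝ 1 fun q : (Fin k → ℝ) × Matrix (Fin k) (Fin k) ℝ => q.2 a b :=
    contDiff_pi.1 (contDiff_pi.1 (contDiff_snd (𝕜 := ℝ) (n := 1) (E := Fin k → ℝ)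
      (F := Fin k → Fin k → ℝ)) a) b
  refine (hY i j).prodMk (.prodMk ?_ (.prodMk ?_ ?_))
  · exact contDiff_pi.2 fun l => hY i l
  · exact contDiff_pi.2 fun l => hY j l
  · exact contDiff_pi.2 fun l => contDiff_pi.1 contDiff_fst _

lemma convex_setOf_fst_pos : Convex ℝ {p : ChartParam i j | 0 < p.1} :=
  (convex_Ioi (0 : ℝ)).linear_preimage (LinearMap.fst ℝ ℝ _)

lemma isOpen_setOf_fst_pos : IsOpen {p : ChartParam i j | 0 < p.1} :=
  isOpen_lt continuous_const continuous_fst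

lemma dimH_setOf_fst_pos (hk : 2 ≤ k) (hij : i ≠ j) :
    dimH {p : ChartParam i j | 0 < p.1} = ((3 * k - 5 : ℕ) : ℝ≥0∞) := by
  rw [← finrank_chartParam hk hij]
  refine Real.dimH_of_mem_nhds (x := (1, 0)) (isOpen_setOf_fst_pos.mem_nhds ?_)
  simp

lemma exists_pos_of_mem_Pset {q : (Fin k → ℝ) × Matrix (Fin k) (Fin k) ℝ} (hq : q ∈ Pset k) :
    ∃ i j, i ≠ j ∧ 0 < q.2 i j := by
  obtain ⟨hskew, -, hne, -⟩ := hq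
  have hs (a b : Fin k) : q.2 b a = -q.2 a b := congrFun (congrFun hskew a) b
  obtain ⟨a, b, hab⟩ : ∃ a b, q.2 a b ≠ 0 := by
    by_contra! h
    exact hne (Matrix.ext h)
  have hne : a ≠ b := by
    rintro rfl
    exact hab (by linarith [hs a a])
  rcases hab.lt_or_gt with h | h
  · exact ⟨b, a, hne.symm, by linarith [hs a b]⟩
  · exact ⟨a, b, hne, h⟩

end

/-- `P_k` has Hausdorff dimension `3k − 5`, i.e. codimension `(k² − 5k + 10)/2` in the
`k(k+1)/2`-dimensional group `𝔾_k ≅ ℝᵏ × Skew_k`. -/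
theorem dimH_Pset (k : ℕ) (hk : 2 ≤ k) :
    dimH (Pset k) = ((3 * k - 5 : ℕ) : ℝ≥0∞) := by
  apply le_antisymm
  · have hcover : Pset k ⊆ ⋃ (i : Fin k) (j : Fin k) (_ : i ≠ j),
        chart i j '' {p | 0 < p.1} := by
      intro q hq
      obtain ⟨i, j, hij, hpos⟩ := exists_pos_of_mem_Pset hq
      simp only [Set.mem_iUnion]
      exact ⟨i, j, hij, chartCoord i j q, hpos, chart_chartCoord hij hq hpos.ne'⟩
    refine (dimH_mono hcover).trans ?_
    simp only [dimH_iUnion]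
    refine iSup_le fun i => iSup_le fun j => iSup_le fun hij => ?_
    rw [← dimH_setOf_fst_pos hk hij]
    exact contDiffOn_chart.dimH_image_le convex_setOf_fst_pos subset_rfl
  · let i : Fin k := ⟨0, by omega⟩
    let j : Fin k := ⟨1, by omega⟩
    have hij : i ≠ j := by simp [i, j]
    have hsub : {p : ChartParam i j | 0 < p.1} ⊆ chartCoord i j '' Pset k := fun p hp =>
      ⟨chart i j p, chart_mem_Pset hij (ne_of_gt hp), chartCoord_chart hij (ne_of_gt hp)⟩
    rw [← dimH_setOf_fst_pos hk hij]
    exact (dimH_mono hsub).trans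
      (contDiff_chartCoord.contDiffOn.dimH_image_le convex_univ (Set.subset_univ _))
end
end

section
/- For every k ≥ 2, the topological boundary points of C_k that are not in C_k lie in the abnormal set: closure(C_k) \ C_k ⊆ A_k. -/
open Matrix

noncomputable section

/-- The abnormal set `A_k = ⋃_W (W ⊕ ∧²W)`, the union over all `(k−2)`-dimensional
subspaces `W ⊆ ℝᵏ`, of points `(x,Y)` with `x ∈ W` and column space of `Y` inside `W`. -/
def Aset (k : ℕ) : Set ((Fin k → ℝ) × Matrix (Fin k) (Fin k) ℝ) :=
  {p | p.2ᵀ = -p.2 ∧ ∃ W : Submodule ℝ (Fin k → ℝ), Module.finrank ℝ W = k - 2 ∧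
    p.1 ∈ W ∧ LinearMap.range p.2.mulVecLin ≤ W}

/-- The pairs `(x, Y)` with `Y` skew-symmetric for which some orthonormal pair `u, w` orthogonal
to `x` spans a `Y`-invariant plane. -/
def invariantPlaneSet (k : ℕ) : Set ((Fin k → ℝ) × Matrix (Fin k) (Fin k) ℝ) :=
  {p | p.2ᵀ = -p.2 ∧ ∃ u w : Fin k → ℝ, u ⬝ᵥ u = 1 ∧ w ⬝ᵥ w = 1 ∧ u ⬝ᵥ w = 0 ∧
    p.1 ⬝ᵥ u = 0 ∧ p.1 ⬝ᵥ w = 0 ∧ p.2 *ᵥ u = (w ⬝ᵥ p.2 *ᵥ u) • w ∧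
    p.2 *ᵥ w = (u ⬝ᵥ p.2 *ᵥ w) • u}

theorem abs_le_one_of_dotProduct_self_eq_one {n : Type*} [Fintype n] {u : n → ℝ}
    (hu : u ⬝ᵥ u = 1) (i : n) : |u i| ≤ 1 := by
  have h : u i * u i ≤ u ⬝ᵥ u :=
    Finset.single_le_sum (f := fun j => u j * u j) (fun j _ => mul_self_nonneg (u j))
      (Finset.mem_univ i)
  exact abs_le_one_iff_mul_self_le_one.mpr (hu ▸ h)

theorem isCompact_setOf_dotProduct_self_eq_one (n : Type*) [Fintype n] :
    IsCompact {u : n → ℝ | u ⬝ᵥ u = 1} := by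
  refine (isCompact_univ_pi fun _ : n => isCompact_Icc (a := (-1 : ℝ)) (b := 1)).of_isClosed_subset
    (isClosed_eq (by fun_prop) continuous_const) fun u hu i _ => ?_
  exact abs_le.mp (abs_le_one_of_dotProduct_self_eq_one hu i)

theorem isClosed_invariantPlaneSet (k : ℕ) : IsClosed (invariantPlaneSet k) := by
  let S := {u : Fin k → ℝ | u ⬝ᵥ u = 1}
  have : CompactSpace S := isCompact_iff_compactSpace.mp (isCompact_setOf_dotProduct_self_eq_one _)
  let T : Set ((S × S) × ((Fin k → ℝ) × Matrix (Fin k) (Fin k) ℝ)) :=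
    {q | q.2.2ᵀ = -q.2.2 ∧ q.1.1.1 ⬝ᵥ q.1.2.1 = 0 ∧ q.2.1 ⬝ᵥ q.1.1.1 = 0 ∧
      q.2.1 ⬝ᵥ q.1.2.1 = 0 ∧ q.2.2 *ᵥ q.1.1.1 = (q.1.2.1 ⬝ᵥ q.2.2 *ᵥ q.1.1.1) • q.1.2.1 ∧
      q.2.2 *ᵥ q.1.2.1 = (q.1.1.1 ⬝ᵥ q.2.2 *ᵥ q.1.2.1) • q.1.1.1}
  have hT : IsClosed T := by
    refine (isClosed_eq ?_ ?_).inter <| (isClosed_eq ?_ ?_).inter <| (isClosed_eq ?_ ?_).inter <|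
      (isClosed_eq ?_ ?_).inter <| (isClosed_eq ?_ ?_).inter (isClosed_eq ?_ ?_) <;> fun_prop
  convert isClosedMap_snd_of_compactSpace T hT using 1
  ext p
  constructor
  · rintro ⟨hY, u, w, hu, hw, h⟩
    exact ⟨((⟨u, hu⟩, ⟨w, hw⟩), p), ⟨hY, h⟩, rfl⟩
  · rintro ⟨⟨⟨⟨u, hu⟩, ⟨w, hw⟩⟩, p⟩, ⟨hY, h⟩, rfl⟩
    exact ⟨hY, u, w, hu, hw, h⟩

section Skew

variable {n : Type*} [Fintype n] {Y : Matrix n n ℝ}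

theorem dotProduct_mulVec_of_skew (hY : Yᵀ = -Y) (a b : n → ℝ) :
    a ⬝ᵥ Y *ᵥ b = -(b ⬝ᵥ Y *ᵥ a) := by
  rw [dotProduct_mulVec, ← mulVec_transpose, hY, neg_mulVec, neg_dotProduct, dotProduct_comm]

theorem dotProduct_mulVec_self_of_skew_s12 (hY : Yᵀ = -Y) (a : n → ℝ) : a ⬝ᵥ Y *ᵥ a = 0 := by
  linarith [dotProduct_mulVec_of_skew hY a a]

/-- If `M` is orthogonal then the range of `1 - M` is orthogonal to the fixed vectors of `M`. -/
theorem sub_mulVec_dotProduct_eq_zero [DecidableEq n] {M : Matrix n n ℝ} (hM : M * Mᵀ = 1)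
    (e : n → ℝ) {z : n → ℝ} (hz : M *ᵥ z = z) : (e - M *ᵥ e) ⬝ᵥ z = 0 := by
  have h : Mᵀ *ᵥ z = z := by
    conv_lhs => rw [← hz]
    rw [mulVec_mulVec, mul_eq_one_comm.mp hM, one_mulVec]
  have h' : M *ᵥ e ⬝ᵥ z = e ⬝ᵥ z := by
    rw [dotProduct_comm, dotProduct_mulVec, ← mulVec_transpose, h, dotProduct_comm]
  rw [sub_dotProduct, h', sub_self]

/-- If `v` is an eigenvector of the square of a skew-symmetric `Y` and `Y v ≠ 0`, then normalizing
`v` and `Y v` gives an orthonormal pair spanning a `Y`-invariant plane. -/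
theorem exists_orthonormal_of_skew (hY : Yᵀ = -Y) {v : n → ℝ} (hw : Y *ᵥ v ≠ 0) {μ : ℝ}
    (hμ : Y *ᵥ Y *ᵥ v = μ • v) :
    ∃ a b : ℝ, (a • v) ⬝ᵥ (a • v) = 1 ∧ (b • Y *ᵥ v) ⬝ᵥ (b • Y *ᵥ v) = 1 ∧
      (a • v) ⬝ᵥ (b • Y *ᵥ v) = 0 ∧
      Y *ᵥ (a • v) = ((b • Y *ᵥ v) ⬝ᵥ Y *ᵥ (a • v)) • (b • Y *ᵥ v) ∧
      Y *ᵥ (b • Y *ᵥ v) = ((a • v) ⬝ᵥ Y *ᵥ (b • Y *ᵥ v)) • (a • v) := by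
  have normalize : ∀ z : n → ℝ, z ≠ 0 → ∃ a : ℝ, a * (a * (z ⬝ᵥ z)) = 1 := fun z hz => by
    have hpos : 0 < z ⬝ᵥ z := dotProduct_self_star_pos_iff.mpr hz
    have hs := Real.mul_self_sqrt hpos.le
    have := (Real.sqrt_pos.mpr hpos).ne'
    exact ⟨(√(z ⬝ᵥ z))⁻¹, by field_simp; nlinarith⟩
  have hv : v ≠ 0 := by rintro rfl; simp at hw
  obtain ⟨a, ha⟩ := normalize v hv
  obtain ⟨b, hb⟩ := normalize _ hw
  refine ⟨a, b, by simpa, by simpa, by simp [dotProduct_mulVec_self_of_skew_s12 hY], ?_, ?_⟩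
  · simp only [mulVec_smul, dotProduct_smul, smul_dotProduct, smul_smul, smul_eq_mul]
    congr 1
    linear_combination -a * hb
  · simp only [mulVec_smul, dotProduct_smul, smul_dotProduct, smul_smul, smul_eq_mul, hμ]
    congr 1
    linear_combination -b * μ * ha

end Skew

theorem Cset_subset_invariantPlaneSet (k : ℕ) : Cset k ⊆ invariantPlaneSet k := by
  rintro ⟨x, Y⟩ ⟨hY, -, M, hM, hM1, hMx, hMY, hker⟩
  dsimp only at *
  have hcomm : M * Y = Y * M := by
    rw [← mul_one (M * Y), ← mul_eq_one_comm.mp hM, ← mul_assoc, hMY]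
  have hS : (Y * Y).IsHermitian := by
    rw [IsHermitian, conjTranspose_eq_transpose_of_trivial, transpose_mul, hY, neg_mul_neg]
  obtain ⟨i, hi⟩ : ∃ i, M *ᵥ (hS.eigenvectorBasis i).ofLp ≠ (hS.eigenvectorBasis i).ofLp := by
    by_contra! h
    apply hM1
    apply (toEuclideanLin (𝕜 := ℝ)).injective
    refine hS.eigenvectorBasis.toBasis.ext fun i => ?_
    simp [toLpLin_apply, h]
  set e := (hS.eigenvectorBasis i).ofLp
  have he : Y *ᵥ Y *ᵥ e = hS.eigenvalues i • e := by
    rw [mulVec_mulVec]; exact hS.mulVec_eigenvectorBasis i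
  set v := e - M *ᵥ e with hv_def
  have hYM : ∀ z, Y *ᵥ M *ᵥ z = M *ᵥ Y *ᵥ z := fun z => by simp only [mulVec_mulVec, hcomm]
  have hYv : Y *ᵥ v = Y *ᵥ e - M *ᵥ Y *ᵥ e := by rw [hv_def, mulVec_sub, hYM]
  have hv : v ≠ 0 := sub_ne_zero.mpr hi.symm
  have hμ : Y *ᵥ Y *ᵥ v = hS.eigenvalues i • v := by
    rw [hYv, mulVec_sub, hYM, he, hv_def, mulVec_smul, smul_sub]
  have hw : Y *ᵥ v ≠ 0 := fun h =>
    hv (dotProduct_self_eq_zero.mp (sub_mulVec_dotProduct_eq_zero hM e (hker v h)))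
  obtain ⟨a, b, h1, h2, h3, h4⟩ := exists_orthonormal_of_skew hY hw hμ
  refine ⟨hY, a • v, b • Y *ᵥ v, h1, h2, h3, ?_, ?_, h4⟩
  · rw [dotProduct_comm, smul_dotProduct, sub_mulVec_dotProduct_eq_zero hM e hMx, smul_zero]
  · rw [dotProduct_comm, smul_dotProduct, hYv, sub_mulVec_dotProduct_eq_zero hM _ hMx, smul_zero]

theorem mem_Cset_of_invariant_plane {k : ℕ} {x u w : Fin k → ℝ} {Y : Matrix (Fin k) (Fin k) ℝ}
    (hY : Yᵀ = -Y) (huu : u ⬝ᵥ u = 1) (hww : w ⬝ᵥ w = 1) (huw : u ⬝ᵥ w = 0)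
    (hxu : x ⬝ᵥ u = 0) (hxw : x ⬝ᵥ w = 0) {c : ℝ} (hc : c ≠ 0) (hu : Y *ᵥ u = c • w)
    (hw : Y *ᵥ w = -c • u) : (x, Y) ∈ Cset k := by
  have hwu : w ⬝ᵥ u = 0 := by rwa [dotProduct_comm]
  let P := vecMulVec u u + vecMulVec w w
  have hPv : ∀ v, P *ᵥ v = (u ⬝ᵥ v) • u + (w ⬝ᵥ v) • w := fun v => by
    simp [P, add_mulVec, vecMulVec_mulVec]
  have hPT : Pᵀ = P := by simp [P, transpose_vecMulVec]
  have hPP : P * P = P := by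
    simp [P, mul_add, add_mul, vecMulVec_mul_vecMulVec, huu, hww, huw, hwu]
  have hYT : ∀ v, v ᵥ* Y = -(Y *ᵥ v) := fun v => by
    rw [← mulVec_transpose, hY, neg_mulVec]
  have hPY : P * Y = Y * P := by
    simp only [P, mul_add, add_mul, vecMulVec_mul, mul_vecMulVec, hYT, hu, hw]
    ext i j
    simp [vecMulVec_apply]
    ring
  have hPu : P *ᵥ u = u := by simp [hPv, huu, hwu]
  have hu0 : u ≠ 0 := by rintro rfl; simp at huu
  have hw0 : w ≠ 0 := by rintro rfl; simp at hww
  have fixes : ∀ v, u ⬝ᵥ v = 0 → w ⬝ᵥ v = 0 → (1 - (2 : ℝ) • P) *ᵥ v = v := fun v h h' => by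
    simp [sub_mulVec, smul_mulVec, hPv, h, h']
  have hMT : (1 - (2 : ℝ) • P)ᵀ = 1 - (2 : ℝ) • P := by simp [transpose_sub, hPT]
  have hMM : (1 - (2 : ℝ) • P) * (1 - (2 : ℝ) • P) = 1 := by
    simp only [mul_sub, sub_mul, mul_one, one_mul, smul_mul_assoc, mul_smul_comm, hPP]
    module
  refine ⟨hY, ?_, 1 - (2 : ℝ) • P, ?_, ?_, ?_, ?_, ?_⟩
  · rintro rfl
    exact smul_ne_zero hc hw0 (by simpa using hu.symm)
  · rw [hMT, hMM]
  · intro h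
    have h' := congrArg (· *ᵥ u) h
    simp [sub_mulVec, smul_mulVec, hPu, hu0] at h'
  · exact fixes x (by rwa [dotProduct_comm]) (by rwa [dotProduct_comm])
  · have hcomm : (1 - (2 : ℝ) • P) * Y = Y * (1 - (2 : ℝ) • P) := by
      simp [mul_sub, sub_mul, hPY]
    rw [hMT, hcomm, mul_assoc, hMM, mul_one]
  · intro v hv
    dsimp only at hv
    have h1 := dotProduct_mulVec_of_skew hY u v
    have h2 := dotProduct_mulVec_of_skew hY w v
    simp [hv, hu, hw, hc] at h1 h2
    exact fixes v (by rwa [dotProduct_comm]) (by rwa [dotProduct_comm])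

theorem mem_Aset_of_mulVec_eq_zero {k : ℕ} {x u w : Fin k → ℝ} {Y : Matrix (Fin k) (Fin k) ℝ}
    (hY : Yᵀ = -Y) (huu : u ⬝ᵥ u = 1) (hww : w ⬝ᵥ w = 1) (huw : u ⬝ᵥ w = 0)
    (hxu : x ⬝ᵥ u = 0) (hxw : x ⬝ᵥ w = 0) (hu : Y *ᵥ u = 0) (hw : Y *ᵥ w = 0) :
    (x, Y) ∈ Aset k := by
  have hwu : w ⬝ᵥ u = 0 := by rwa [dotProduct_comm]
  let f := (of ![u, w]).mulVecLin
  have hf : ∀ z, f z = ![u ⬝ᵥ z, w ⬝ᵥ z] := fun z => by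
    ext i
    fin_cases i <;> rfl
  have hmem : ∀ z, u ⬝ᵥ z = 0 → w ⬝ᵥ z = 0 → z ∈ LinearMap.ker f := fun z h h' => by
    simp [LinearMap.mem_ker, hf, h, h']
  have hsurj : LinearMap.range f = ⊤ := by
    refine LinearMap.range_eq_top.mpr fun y => ⟨y 0 • u + y 1 • w, ?_⟩
    ext i
    fin_cases i <;> simp [hf, huu, hww, huw, hwu]
  refine ⟨hY, LinearMap.ker f, ?_, ?_, ?_⟩
  · have h := f.finrank_range_add_finrank_ker
    rw [hsurj, finrank_top, Module.finrank_fin_fun, Module.finrank_fin_fun] at h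
    lia
  · exact hmem x (by rwa [dotProduct_comm]) (by rwa [dotProduct_comm])
  · rintro _ ⟨z, rfl⟩
    refine hmem _ ?_ ?_ <;> rw [mulVecLin_apply, dotProduct_mulVec_of_skew hY]
    · simp [hu]
    · simp [hw]

theorem invariantPlaneSet_subset (k : ℕ) : invariantPlaneSet k ⊆ Cset k ∪ Aset k := by
  rintro ⟨x, Y⟩ ⟨hY, u, w, huu, hww, huw, hxu, hxw, hu, hw⟩
  dsimp only at *
  rw [dotProduct_mulVec_of_skew hY] at hw
  by_cases hc : w ⬝ᵥ Y *ᵥ u = 0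
  · rw [hc, zero_smul] at hu
    rw [hc, neg_zero, zero_smul] at hw
    exact .inr (mem_Aset_of_mulVec_eq_zero hY huu hww huw hxu hxw hu hw)
  · exact .inl (mem_Cset_of_invariant_plane hY huu hww huw hxu hxw hc hu hw)

/-- The topological boundary points of `C_k` that are not in `C_k` lie in the abnormal set. -/
theorem closure_Cset_diff_subset_Aset (k : ℕ) (hk : 2 ≤ k) :
    closure (Cset k) \ Cset k ⊆ Aset k := by
  rw [Set.sdiff_subset_iff]
  exact (closure_minimal (Cset_subset_invariantPlaneSet k) (isClosed_invariantPlaneSet k)).trans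
    (invariantPlaneSet_subset k)
end
end

section
/- For every k ≥ 2, the abnormal set A_k is a proper subset of the closure of C_k: A_k ⊆ closure(C_k), and there exists a point of C_k (for instance any (x,Y) ∈ C_k with Y of maximal rank 2⌊k/2⌋) that does not belong to A_k. -/
open Matrix

noncomputable section

/-- A subspace of codimension two in `ℝᵏ` has an orthonormal pair orthogonal to it. -/
lemma exists_orthonormal_pair_of_finrank_add_two {k : ℕ} (W : Submodule ℝ (Fin k → ℝ))
    (hW : Module.finrank ℝ W + 2 = k) :
    ∃ u v : Fin k → ℝ, u ⬝ᵥ u = 1 ∧ v ⬝ᵥ v = 1 ∧ u ⬝ᵥ v = 0 ∧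
      ∀ w ∈ W, u ⬝ᵥ w = 0 ∧ v ⬝ᵥ w = 0 := by
  let e := (WithLp.linearEquiv 2 ℝ (Fin k → ℝ)).symm
  let V : Submodule ℝ (EuclideanSpace ℝ (Fin k)) := W.map e.toLinearMap
  have hV : Module.finrank ℝ V = Module.finrank ℝ W := LinearEquiv.finrank_map_eq e W
  have hVo : Module.finrank ℝ Vᗮ = 2 := by
    have h := V.finrank_add_finrank_orthogonal
    rw [finrank_euclideanSpace_fin] at h
    omega
  let b := (stdOrthonormalBasis ℝ Vᗮ).reindex (finCongr hVo)
  have inner_eq (x y : EuclideanSpace ℝ (Fin k)) : x.ofLp ⬝ᵥ y.ofLp = inner ℝ x y := by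
    rw [EuclideanSpace.inner_eq_star_dotProduct, dotProduct_comm]
    rfl
  have hb (i j : Fin 2) :
      (b i : EuclideanSpace ℝ (Fin k)).ofLp ⬝ᵥ (b j : EuclideanSpace ℝ (Fin k)).ofLp =
        if i = j then 1 else 0 := by
    rw [inner_eq, ← Submodule.coe_inner]
    exact orthonormal_iff_ite.mp b.orthonormal i j
  have hbW (i : Fin 2) (w : Fin k → ℝ) (hw : w ∈ W) :
      (b i : EuclideanSpace ℝ (Fin k)).ofLp ⬝ᵥ w = 0 :=
    (inner_eq (b i) (e w)).trans
      (Submodule.inner_left_of_mem_orthogonal (Submodule.mem_map_of_mem hw) (b i).2)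
  exact ⟨_, _, by simpa using hb 0 0, by simpa using hb 1 1, by simpa using hb 0 1,
    fun w hw => ⟨hbW 0 w hw, hbW 1 w hw⟩⟩

/-- Adding a multiple of `u ∧ v`, for an orthonormal pair `u, v` orthogonal to `x` and to the
range of `Y`, moves `(x, Y)` into the cut set. -/
lemma add_smul_wedge_mem_Cset {k : ℕ} {x u v : Fin k → ℝ} {Y : Matrix (Fin k) (Fin k) ℝ}
    (hY : Yᵀ = -Y) (huu : u ⬝ᵥ u = 1) (hvv : v ⬝ᵥ v = 1) (huv : u ⬝ᵥ v = 0)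
    (hux : u ⬝ᵥ x = 0) (hvx : v ⬝ᵥ x = 0) (huY : ∀ w, u ⬝ᵥ Y *ᵥ w = 0)
    (hvY : ∀ w, v ⬝ᵥ Y *ᵥ w = 0) {ε : ℝ} (hε : ε ≠ 0) :
    (x, Y + ε • (vecMulVec u v - vecMulVec v u)) ∈ Cset k := by
  have hvu : v ⬝ᵥ u = 0 := by rw [dotProduct_comm, huv]
  have huY0 : u ᵥ* Y = 0 := dotProduct_eq_zero _ fun w => by rw [← dotProduct_mulVec, huY]
  have hvY0 : v ᵥ* Y = 0 := dotProduct_eq_zero _ fun w => by rw [← dotProduct_mulVec, hvY]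
  have hYu : Y *ᵥ u = 0 := by
    rw [← vecMul_transpose, hY, vecMul_neg, huY0, neg_zero]
  have hYv : Y *ᵥ v = 0 := by
    rw [← vecMul_transpose, hY, vecMul_neg, hvY0, neg_zero]
  set Z := Y + ε • (vecMulVec u v - vecMulVec v u) with hZ
  have hZw (w : Fin k → ℝ) : Z *ᵥ w = Y *ᵥ w + ε • ((v ⬝ᵥ w) • u - (u ⬝ᵥ w) • v) := by
    simp [hZ, add_mulVec, sub_mulVec, smul_mulVec, vecMulVec_mulVec]
  let P := vecMulVec u u + vecMulVec v v
  have hPT : Pᵀ = P := by simp [P, transpose_vecMulVec]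
  have hPw (w : Fin k → ℝ) : P *ᵥ w = (u ⬝ᵥ w) • u + (v ⬝ᵥ w) • v := by
    simp [P, add_mulVec, vecMulVec_mulVec]
  have hPP : P * P = P := by
    simp [P, add_mul, mul_add, vecMulVec_mul_vecMulVec, huu, hvv, huv, hvu]
  have hPZ : P * Z = Z * P := by
    have hPY : P * Y = 0 := by simp [P, add_mul, vecMulVec_mul, huY0, hvY0]
    have hYP : Y * P = 0 := by simp [P, mul_add, mul_vecMulVec, hYu, hYv]
    rw [hZ, mul_add, add_mul Y, hPY, hYP]
    simp [P, add_mul, mul_add, sub_mul, mul_sub, vecMulVec_mul_vecMulVec, huu, hvv, huv, hvu]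
    module
  have hMw (w : Fin k → ℝ) (hu : u ⬝ᵥ w = 0) (hv : v ⬝ᵥ w = 0) :
      (1 - (2 : ℝ) • P) *ᵥ w = w := by
    simp [sub_mulVec, smul_mulVec, hPw, hu, hv]
  have hMM : (1 - (2 : ℝ) • P) * (1 - (2 : ℝ) • P) = 1 := by
    simp only [sub_mul, mul_sub, one_mul, mul_one, smul_mul_assoc, mul_smul_comm, hPP]
    module
  have hMT : (1 - (2 : ℝ) • P)ᵀ = 1 - (2 : ℝ) • P := by simp [hPT]
  refine ⟨?_, fun h => ?_, 1 - (2 : ℝ) • P, by rw [hMT, hMM], fun h => ?_, hMw x hux hvx, ?_,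
    fun w hw => ?_⟩
  · simp [hZ, hY, transpose_vecMulVec]
    module
  · have h' := congrArg (u ⬝ᵥ ·) (hZw v)
    simp only [show Z = 0 from h] at h'
    simp [hYv, huu, hvv, huv, hε.symm] at h'
  · have h' := congrArg (fun N => u ⬝ᵥ N *ᵥ u) h
    simp [sub_mulVec, smul_mulVec, hPw, huu, hvu] at h'
  · change (1 - (2 : ℝ) • P) * Z * (1 - (2 : ℝ) • P)ᵀ = Z
    have hc : (1 - (2 : ℝ) • P) * Z = Z * (1 - (2 : ℝ) • P) := by
      simp [sub_mul, mul_sub, hPZ]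
    rw [hMT, hc, mul_assoc, hMM, mul_one]
  · have h' : Z *ᵥ w = 0 := hw
    rw [hZw] at h'
    have h₁ := congrArg (u ⬝ᵥ ·) h'
    have h₂ := congrArg (v ⬝ᵥ ·) h'
    simp [huY, huu, huv, hε] at h₁
    simp [hvY, hvv, hvu, hε] at h₂
    exact hMw w h₂ h₁

lemma Aset_subset_closure_Cset {k : ℕ} (hk : 2 ≤ k) : Aset k ⊆ closure (Cset k) := by
  rintro ⟨x, Y⟩ ⟨hY, W, hW, hx, hYW⟩
  obtain ⟨u, v, huu, hvv, huv, h⟩ :=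
    exists_orthonormal_pair_of_finrank_add_two W (by omega)
  have hYw (w : Fin k → ℝ) : Y *ᵥ w ∈ W := hYW ⟨w, rfl⟩
  let γ : ℝ → (Fin k → ℝ) × Matrix (Fin k) (Fin k) ℝ :=
    fun ε => (x, Y + ε • (vecMulVec u v - vecMulVec v u))
  have hγ : Continuous γ := by fun_prop
  have hγ0 : γ 0 = (x, Y) := by simp [γ]
  rw [← hγ0]
  refine mem_closure_of_tendsto (hγ.continuousWithinAt (s := {0}ᶜ)) ?_
  filter_upwards [self_mem_nhdsWithin] with ε hε
  exact add_smul_wedge_mem_Cset hY huu hvv huv (h x hx).1 (h x hx).2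
    (fun w => (h _ (hYw w)).1) (fun w => (h _ (hYw w)).2) hε

/-- In every dimension there is a skew-symmetric partial isometry of maximal rank. -/
lemma exists_skew_cube_eq_neg_rank (k : ℕ) :
    ∃ Y : Matrix (Fin k) (Fin k) ℝ, Yᵀ = -Y ∧ Y * Y * Y = -Y ∧ Y.rank = 2 * (k / 2) := by
  let e : (Fin (k / 2) ⊕ Fin (k / 2)) ⊕ Fin (k % 2) ≃ Fin k :=
    Fintype.equivFinOfCardEq (by simp; omega)
  let B : Matrix ((Fin (k / 2) ⊕ Fin (k / 2)) ⊕ Fin (k % 2))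
      ((Fin (k / 2) ⊕ Fin (k / 2)) ⊕ Fin (k % 2)) ℝ :=
    fromBlocks (Matrix.J (Fin (k / 2)) ℝ) 0 0 0
  have hBT : Bᵀ = -B := by simp [B, fromBlocks_transpose, fromBlocks_neg, J_transpose]
  have hBB : B * B = fromBlocks (-1) 0 0 0 := by
    simp [B, fromBlocks_multiply, J_squared]
  have hBBB : B * B * B = -B := by
    rw [hBB]
    simp [B, fromBlocks_multiply, fromBlocks_neg]
  have hrank : B.rank = 2 * (k / 2) := by
    have hd : Bᵀ * B = diagonal (Sum.elim 1 0) := by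
      rw [hBT, neg_mul, hBB, fromBlocks_neg, ← fromBlocks_diagonal]
      simp
    rw [← rank_transpose_mul_self, hd, rank_diagonal, Fintype.card_subtype, Finset.card_filter,
      Fintype.sum_sum_type]
    simp
    omega
  refine ⟨reindex e e B, ?_, ?_, by rw [rank_reindex, hrank]⟩
  · rw [transpose_reindex, hBT]
    rfl
  · simp only [reindex_apply, submatrix_mul_equiv, hBBB]
    rfl

lemma zero_mem_Cset_of_cube_eq_neg {k : ℕ} {Y : Matrix (Fin k) (Fin k) ℝ} (hT : Yᵀ = -Y)
    (hY : Y * Y * Y = -Y) (h0 : Y ≠ 0) : ((0, Y) : _ × _) ∈ Cset k := by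
  have hMT : (1 + (2 : ℝ) • (Y * Y))ᵀ = 1 + (2 : ℝ) • (Y * Y) := by
    simp [transpose_mul, hT]
  have hMY : (1 + (2 : ℝ) • (Y * Y)) * Y = -Y := by
    rw [add_mul, smul_mul_assoc, hY, one_mul]
    module
  have hYM : Y * (1 + (2 : ℝ) • (Y * Y)) = -Y := by
    rw [mul_add, mul_smul_comm, ← mul_assoc, hY, mul_one]
    module
  refine ⟨hT, h0, 1 + (2 : ℝ) • (Y * Y), ?_, fun h => ?_, mulVec_zero _, ?_, fun v hv => ?_⟩
  · rw [hMT, mul_add, mul_smul_comm, ← mul_assoc, hMY, neg_mul, mul_one]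
    module
  · rw [h, one_mul] at hMY
    refine h0 (Matrix.ext fun i j => ?_)
    exact self_eq_neg.mp (congrFun₂ hMY i j)
  · change (1 + (2 : ℝ) • (Y * Y)) * Y * (1 + (2 : ℝ) • (Y * Y))ᵀ = Y
    rw [hMT, hMY, neg_mul, hYM, neg_neg]
  · have hv' : Y *ᵥ v = 0 := hv
    rw [add_mulVec, smul_mulVec, ← mulVec_mulVec, hv']
    simp

lemma notMem_Aset_of_lt_rank {k : ℕ} {p : (Fin k → ℝ) × Matrix (Fin k) (Fin k) ℝ}
    (h : k - 2 < p.2.rank) : p ∉ Aset k := by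
  rintro ⟨-, W, hW, -, hYW⟩
  have hle : p.2.rank ≤ Module.finrank ℝ W := Submodule.finrank_mono hYW
  omega

/-- The abnormal set is a proper subset of the closure of `C_k`: it is contained in
`closure C_k`, and there is a point of `C_k` (with `Y` of maximal rank `2⌊k/2⌋`)
not belonging to `A_k`. -/
theorem Aset_ssubset_closure_Cset (k : ℕ) (hk : 2 ≤ k) :
    Aset k ⊆ closure (Cset k) ∧
    ∃ p ∈ Cset k, p.2.rank = 2 * (k / 2) ∧ p ∉ Aset k := by
  obtain ⟨Y, hT, hY, hrank⟩ := exists_skew_cube_eq_neg_rank k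
  have h0 : Y ≠ 0 := by
    rintro rfl
    rw [rank_zero] at hrank
    omega
  exact ⟨Aset_subset_closure_Cset hk, (0, Y), zero_mem_Cset_of_cube_eq_neg hT hY h0, hrank,
    notMem_Aset_of_lt_rank (by change k - 2 < Y.rank; omega)⟩
end
end

section
/- For every k ≥ 4 and every α > 0, the point (0, Y) with Y the block-diagonal skew-symmetric matrix diag(α J₂, 0_{k−2}) (where J₂ = [[0,1],[−1,0]]) belongs to both C_k and A_k; in particular C_k ∩ A_k ≠ ∅, so the set of cut points C_k intersects the abnormal set. -/
open Matrix

noncomputable section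

/-- The block-diagonal skew-symmetric matrix `diag(α J₂, 0_{k−2})`, where
`J₂ = [[0,1],[−1,0]]`. -/
def cornerJ (k : ℕ) (α : ℝ) : Matrix (Fin k) (Fin k) ℝ :=
  Matrix.of fun i j =>
    if (i : ℕ) = 0 ∧ (j : ℕ) = 1 then α
    else if (i : ℕ) = 1 ∧ (j : ℕ) = 0 then -α
    else 0

theorem cornerJ_transpose (k : ℕ) (α : ℝ) : (cornerJ k α)ᵀ = -cornerJ k α := by
  ext i j
  rw [transpose_apply, Matrix.neg_apply]
  simp only [cornerJ, of_apply]
  split_ifs <;> first | omega | simp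

theorem cornerJ_mulVec_zero (n : ℕ) (α : ℝ) (v : Fin (n + 2) → ℝ) :
    (cornerJ (n + 2) α *ᵥ v) 0 = α * v 1 := by
  rw [mulVec, dotProduct, Finset.sum_eq_single 1]
  · simp [cornerJ]
  · intro j _ hj
    have : (j : ℕ) ≠ 1 := fun h => hj (Fin.ext (by simpa using h))
    simp [cornerJ, this]
  · simp

theorem cornerJ_mulVec_one (n : ℕ) (α : ℝ) (v : Fin (n + 2) → ℝ) :
    (cornerJ (n + 2) α *ᵥ v) 1 = -α * v 0 := by
  rw [mulVec, dotProduct, Finset.sum_eq_single 0]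
  · simp [cornerJ]
  · intro j _ hj
    simp [cornerJ, hj]
  · simp

theorem cornerJ_mulVec_of_two_le {k : ℕ} (α : ℝ) (v : Fin k → ℝ) {i : Fin k}
    (hi : 2 ≤ (i : ℕ)) : (cornerJ k α *ᵥ v) i = 0 := by
  rw [mulVec, dotProduct]
  refine Finset.sum_eq_zero fun j _ => ?_
  simp [cornerJ, show (i : ℕ) ≠ 0 by omega, show (i : ℕ) ≠ 1 by omega]

theorem finrank_ker_two_coordinates {k : ℕ} {a b : Fin k} (hab : a ≠ b) :
    Module.finrank ℝ (LinearMap.ker ((LinearMap.proj a : (Fin k → ℝ) →ₗ[ℝ] ℝ).prod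
      (LinearMap.proj b))) = k - 2 := by
  have hsurj : LinearMap.range ((LinearMap.proj a : (Fin k → ℝ) →ₗ[ℝ] ℝ).prod
      (LinearMap.proj b)) = ⊤ := by
    rw [LinearMap.range_eq_top]
    rintro ⟨x, y⟩
    exact ⟨fun i => if i = a then x else y, by simp [hab.symm]⟩
  have h := LinearMap.finrank_range_add_finrank_ker
    ((LinearMap.proj a : (Fin k → ℝ) →ₗ[ℝ] ℝ).prod (LinearMap.proj b))
  rw [hsurj, finrank_top, Module.finrank_prod, Module.finrank_self, Module.finrank_fin_fun] at h
  omega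

theorem cornerJ_mem_Cset (n : ℕ) {α : ℝ} (hα : α ≠ 0) :
    ((0 : Fin (n + 2) → ℝ), cornerJ (n + 2) α) ∈ Cset (n + 2) := by
  refine ⟨cornerJ_transpose _ α, fun h => hα ?_,
    diagonal fun i => if (i : ℕ) < 2 then -1 else 1, ?_, fun h => ?_, mulVec_zero _, ?_,
    fun v hv => ?_⟩
  · simpa [cornerJ] using congrFun (congrFun h 0) 1
  · rw [diagonal_transpose, diagonal_mul_diagonal, ← diagonal_one]
    congr 1
    ext i
    split_ifs <;> norm_num
  · have := congrFun (congrFun h 0) 0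
    norm_num at this
  · ext i j
    rw [diagonal_transpose, mul_diagonal, diagonal_mul]
    simp only [cornerJ, of_apply]
    split_ifs <;> first | omega | simp
  · have h0 : v 0 = 0 := by
      simpa [cornerJ_mulVec_one, hα] using congrFun hv 1
    have h1 : v 1 = 0 := by
      simpa [cornerJ_mulVec_zero, hα] using congrFun hv 0
    ext i
    rw [mulVec_diagonal]
    split_ifs with hi
    · obtain rfl | rfl : i = 0 ∨ i = 1 := by
        simp only [Fin.ext_iff, Fin.val_zero, Fin.val_one]
        omega
      · simp [h0]
      · simp [h1]
    · simp

theorem cornerJ_mem_Aset {k : ℕ} (hk : 4 ≤ k) (α : ℝ) :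
    ((0 : Fin k → ℝ), cornerJ k α) ∈ Aset k := by
  refine ⟨cornerJ_transpose k α, _,
    finrank_ker_two_coordinates (a := ⟨2, by omega⟩) (b := ⟨3, by omega⟩) (by simp),
    Submodule.zero_mem _, ?_⟩
  rintro _ ⟨v, rfl⟩
  simp [cornerJ_mulVec_of_two_le]

/-- For `k ≥ 4` and `α > 0`, the point `(0, diag(α J₂, 0_{k−2}))` belongs to both `C_k` and
the abnormal set `A_k`; in particular the set of cut points intersects the abnormal set. -/
theorem Cset_inter_Aset_nonempty (k : ℕ) (hk : 4 ≤ k) (α : ℝ) (hα : 0 < α) :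
    ((0 : Fin k → ℝ), cornerJ k α) ∈ Cset k ∧
    ((0 : Fin k → ℝ), cornerJ k α) ∈ Aset k ∧
    (Cset k ∩ Aset k).Nonempty := by
  obtain ⟨n, rfl⟩ : ∃ n, k = n + 2 := ⟨k - 2, by omega⟩
  have hC := cornerJ_mem_Cset n hα.ne'
  have hA := cornerJ_mem_Aset hk α
  exact ⟨hC, hA, _, hC, hA⟩
end
end
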